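/- arXiv:1703.10512 — 7 statements merged into one kernel-verified Lean document; each statement's English description precedes it below -/
import Mathlib

section
/- For every μ ∈ {0, 1, 5/(3√3), 2/√3, −2/√3}, the system (S2) has no real solution (A,B,C,D,E,F,X,Y,Z,W,𝒞) with A,B,C,D,E,F > 0. -/
/-- The system (S2) of 12 polynomial equations arising from left-invariant Einstein
metrics on S³×S³ invariant under a ℤ₂ subgroup of inner automorphisms.
Here `G` denotes the variable `𝒞`. -/
def SystemS2 (A B C D E F X Y Z W G μ : ℝ) : Prop :=
  A*B*C*D*E*F - 1 = 0 ∧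
  -D + E + F + A*B*C*E*F*μ - D*X^2 + A*X*Y*Z - A*W*X*G = 0 ∧
  D - E + F + A*B*C*D*F*μ - E*W^2 - E*Y^2 + B*X*Y*Z - C*W*X*G = 0 ∧
  A - B + C + A*C*D*E*F*μ + A*W^2 - B*W^2 - B*X^2 + C*X^2 - B*W^2*X^2 + E*X*Y*Z
    + A*Z^2 - B*Z^2 - B*X^2*Z^2 - F*W*X*G = 0 ∧
  D + E - F + A*B*C*D*E*μ + C*X*Y*Z - F*Z^2 - B*W*X*G - F*G^2 = 0 ∧
  -A + B + C + B*C*D*E*F*μ - A*W^2 + B*W^2 - A*Y^2 + C*Y^2 + D*X*Y*Z - A*Z^2 + B*Z^2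
    - A*Y^2*Z^2 - D*W*X*G + 2*A*W*Y*Z*G - A*G^2 + C*G^2 - A*W^2*G^2 = 0 ∧
  A + B - C + A*B*D*E*F*μ + B*X^2 - C*X^2 + A*Y^2 - C*Y^2 - C*X^2*Y^2 + F*X*Y*Z
    - E*W*X*G + A*G^2 - C*G^2 - C*X^2*G^2 = 0 ∧
  -(A*D*W*X) - C*E*W*X - B*F*W*X + A^2*W*Y*Z - A^2*G + 2*A*C*G - C^2*G - F^2*G
    - A^2*W^2*G - C^2*X^2*G = 0 ∧
  A*D*X*Y + B*E*X*Y + C*F*X*Y - A^2*Z + 2*A*B*Z - B^2*Z - F^2*Z - B^2*X^2*Z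
    - A^2*Y^2*Z + A^2*W*Y*G = 0 ∧
  -(A^2*Y) + 2*A*C*Y - C^2*Y - E^2*Y - C^2*X^2*Y + A*D*X*Z + B*E*X*Z + C*F*X*Z
    - A^2*Y*Z^2 + A^2*W*Z*G = 0 ∧
  -(A^2*W) + 2*A*B*W - B^2*W - E^2*W - B^2*W*X^2 - A*D*X*G - C*E*X*G - B*F*X*G
    + A^2*Y*Z*G - A^2*W*G^2 = 0 ∧
  -(B^2*X) + 2*B*C*X - C^2*X - D^2*X - B^2*W^2*X - C^2*X*Y^2 + A*D*Y*Z + B*E*Y*Z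
    + C*F*Y*Z - B^2*X*Z^2 - A*D*W*G - C*E*W*G - B*F*W*G - C^2*X*G^2 = 0

/-- The Einstein equations of a left-invariant metric on `S³ × S³` in a form adapted to
estimates: `p, y, w, z, g` are the structure constants coupling the two factors and `m = -μ`. -/
structure EinsteinSystem (m A B C D E F X Y Z W G p y w z g : ℝ) : Prop where
  hA : 0 < A
  hB : 0 < B
  hC : 0 < C
  hD : 0 < D
  hE : 0 < E
  hF : 0 < F
  vol : A * B * C * D * E * F = 1
  hp : p = D * X - A * (Y * Z - W * G)
  hy : y = E * Y - B * X * Z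
  hw : w = E * W + C * X * G
  hz : z = F * Z - C * X * Y
  hg : g = F * G + B * X * W
  H1 : m = D ^ 2 - (E - F) ^ 2 - (y ^ 2 + w ^ 2) - (z ^ 2 + g ^ 2) - (B - C) ^ 2 * X ^ 2
  H2 : m = E ^ 2 - (D - F) ^ 2 - p ^ 2 - (z ^ 2 + g ^ 2) - (A - B) ^ 2 * W ^ 2
    - (A - C) ^ 2 * Y ^ 2
  H3 : m = F ^ 2 - (D - E) ^ 2 - p ^ 2 - (y ^ 2 + w ^ 2) - (A - B) ^ 2 * Z ^ 2
    - (A - C) ^ 2 * G ^ 2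
  V1 : m = A ^ 2 - (B - C) ^ 2 + p ^ 2 + (A ^ 2 - B ^ 2) * (W ^ 2 + Z ^ 2)
    + (A ^ 2 - C ^ 2) * (Y ^ 2 + G ^ 2)
  V2 : m = B ^ 2 - (A - C) ^ 2 + y ^ 2 + g ^ 2 - (A ^ 2 - B ^ 2) * (W ^ 2 + Z ^ 2)
    + (B ^ 2 - C ^ 2) * X ^ 2
  V3 : m = C ^ 2 - (A - B) ^ 2 + z ^ 2 + w ^ 2 - (A ^ 2 - C ^ 2) * (Y ^ 2 + G ^ 2)
    - (B ^ 2 - C ^ 2) * X ^ 2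
  OY : E * y - A * Z * p - C * X * z + (A - C) ^ 2 * Y = 0
  OZ : F * z - A * Y * p - B * X * y + (A - B) ^ 2 * Z = 0
  OW : E * w + A * G * p + B * X * g + (A - B) ^ 2 * W = 0
  OG : F * g + A * W * p + C * X * w + (A - C) ^ 2 * G = 0
  OX : D * p - B * Z * y - C * Y * z + C * G * w + B * W * g + (B - C) ^ 2 * X = 0

theorem SystemS2.einsteinSystem {A B C D E F X Y Z W G μ : ℝ} (hA : 0 < A) (hB : 0 < B)
    (hC : 0 < C) (hD : 0 < D) (hE : 0 < E) (hF : 0 < F) (h : SystemS2 A B C D E F X Y Z W G μ) :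
    EinsteinSystem (-μ) A B C D E F X Y Z W G (D * X - A * (Y * Z - W * G))
      (E * Y - B * X * Z) (E * W + C * X * G) (F * Z - C * X * Y) (F * G + B * X * W) := by
  obtain ⟨h1, h2, h3, h4, h5, h6, h7, h8, h9, h10, h11, h12⟩ := h
  constructor <;> try first | assumption | rfl
  · linear_combination h1
  · linear_combination D * h2 - E * h3 - F * h5 + μ * h1 - X * h12
  · linear_combination E * h3 - D * h2 - F * h5 + μ * h1 - Y * h10 - W * h11
  · linear_combination F * h5 - D * h2 - E * h3 + μ * h1 - Z * h9 - G * h8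
  · linear_combination A * h6 - B * h4 - C * h7 + μ * h1 + X * h12
  · linear_combination B * h4 - A * h6 - C * h7 + μ * h1 + Y * h10 + G * h8
  · linear_combination C * h7 - A * h6 - B * h4 + μ * h1 + Z * h9 + W * h11
  · linear_combination -h10
  · linear_combination -h9
  · linear_combination -h11
  · linear_combination -h8
  · linear_combination -h12

namespace EinsteinSystem

variable {m A B C D E F X Y Z W G p y w z g : ℝ}

theorem false_of_nonpos (h : EinsteinSystem m A B C D E F X Y Z W G p y w z g) (hm : m ≤ 0) :
    False := by
  obtain ⟨hA, hB, hC, -, -, -, -, -, -, -, -, -, -, -, -, V1, V2, V3, -, -, -, -, -⟩ := h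
  have key : ∀ a b c : ℝ, 0 < a → 0 < b → 0 < c → b ≤ a → c ≤ a → 0 < a ^ 2 - (b - c) ^ 2 := by
    intro a b c _ _ _ _ _
    have : 0 < (a - b + c) * (a + b - c) := mul_pos (by linarith) (by linarith)
    linarith
  have hsq : ∀ a b : ℝ, 0 < a → 0 < b → b ≤ a → 0 ≤ a ^ 2 - b ^ 2 := by
    intro a b _ _ _; nlinarith
  have n1 := add_nonneg (sq_nonneg W) (sq_nonneg Z)
  have n2 := add_nonneg (sq_nonneg Y) (sq_nonneg G)
  have n3 := sq_nonneg X
  rcases le_total A B with h1 | h1 <;> rcases le_total B C with h2 | h2 <;>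
    rcases le_total A C with h3 | h3
  all_goals first
    | (have := key A B C hA hB hC (by linarith) (by linarith)
       have q1 := mul_nonneg (hsq A B hA hB (by linarith)) n1
       have q2 := mul_nonneg (hsq A C hA hC (by linarith)) n2
       nlinarith [sq_nonneg p])
    | (have := key B A C hB hA hC (by linarith) (by linarith)
       have q1 := mul_nonneg (hsq B A hB hA (by linarith)) n1
       have q2 := mul_nonneg (hsq B C hB hC (by linarith)) n3
       nlinarith [sq_nonneg y, sq_nonneg g])
    | (have := key C A B hC hA hB (by linarith) (by linarith)
       have q1 := mul_nonneg (hsq C A hC hA (by linarith)) n2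
       have q2 := mul_nonneg (hsq C B hC hB (by linarith)) n3
       nlinarith [sq_nonneg z, sq_nonneg w])

theorem neg (h : EinsteinSystem m A B C D E F X Y Z W G p y w z g) :
    EinsteinSystem m A B C D E F (-X) (-Y) Z (-W) G (-p) (-y) (-w) z g := by
  obtain ⟨hA, hB, hC, hD, hE, hF, vol, hp, hy, hw, hz, hg, H1, H2, H3, V1, V2, V3, OY, OZ, OW,
    OG, OX⟩ := h
  constructor <;> try first | assumption
  · linear_combination -hp
  · linear_combination -hy
  · linear_combination -hw
  · linear_combination hz
  · linear_combination hg
  · linear_combination H1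
  · linear_combination H2
  · linear_combination H3
  · linear_combination V1
  · linear_combination V2
  · linear_combination V3
  · linear_combination -OY
  · linear_combination OZ
  · linear_combination -OW
  · linear_combination OG
  · linear_combination -OX

/-- The symmetry exchanging `B` and `C`. -/
theorem swap (h : EinsteinSystem m A B C D E F X Y Z W G p y w z g) :
    EinsteinSystem m A C B D E F X W (-G) Y (-Z) p w y (-g) (-z) := by
  obtain ⟨hA, hB, hC, hD, hE, hF, vol, hp, hy, hw, hz, hg, H1, H2, H3, V1, V2, V3, OY, OZ, OW,
    OG, OX⟩ := h
  constructor <;> try first | assumption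
  · linear_combination vol
  · linear_combination hp
  · linear_combination hw
  · linear_combination hy
  · linear_combination -hg
  · linear_combination -hz
  · linear_combination H1
  · linear_combination H2
  · linear_combination H3
  · linear_combination V1
  · linear_combination V3
  · linear_combination V2
  · linear_combination OW
  · linear_combination -OG
  · linear_combination OY
  · linear_combination -OZ
  · linear_combination OX

/-- A diagonal solution stays a solution under exchanging `(A, D, X)` and `(B, E, Y)`. -/
theorem diag_swap_AB (h : EinsteinSystem m A B C D E F X Y Z 0 0 p y w z g) :
    EinsteinSystem m B A C E D F Y X Z 0 0 y p 0 z 0 := by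
  obtain ⟨hA, hB, hC, hD, hE, hF, vol, hp, hy, hw, hz, hg, H1, H2, H3, V1, V2, V3, OY, OZ, OW,
    OG, OX⟩ := h
  have hw0 : w = 0 := by linear_combination hw
  have hg0 : g = 0 := by linear_combination hg
  subst hw0 hg0
  constructor <;> try first | assumption | ring1
  · linear_combination vol
  · linear_combination hy
  · linear_combination hp
  · linear_combination hz
  · linear_combination H2
  · linear_combination H1
  · linear_combination H3
  · linear_combination V2
  · linear_combination V1
  · linear_combination V3
  · linear_combination OX
  · linear_combination OZ
  · linear_combination OY

/-- A diagonal solution stays a solution under exchanging `(A, D, X)` and `(C, F, Z)`. -/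
theorem diag_swap_AC (h : EinsteinSystem m A B C D E F X Y Z 0 0 p y w z g) :
    EinsteinSystem m C B A F E D Z Y X 0 0 z y 0 p 0 := by
  obtain ⟨hA, hB, hC, hD, hE, hF, vol, hp, hy, hw, hz, hg, H1, H2, H3, V1, V2, V3, OY, OZ, OW,
    OG, OX⟩ := h
  have hw0 : w = 0 := by linear_combination hw
  have hg0 : g = 0 := by linear_combination hg
  subst hw0 hg0
  constructor <;> try first | assumption | ring1
  · linear_combination vol
  · linear_combination hz
  · linear_combination hy
  · linear_combination hp
  · linear_combination H3
  · linear_combination H2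
  · linear_combination H1
  · linear_combination V3
  · linear_combination V2
  · linear_combination V1
  · linear_combination OY
  · linear_combination OX
  · linear_combination OZ

end EinsteinSystem

theorem schur_cubic {x y z : ℝ} (hx : 0 ≤ x) (hy : 0 ≤ y) (hz : 0 ≤ z) :
    (2 * (x * y + y * z + z * x) - x ^ 2 - y ^ 2 - z ^ 2) * (x + y + z) ≤ 9 * (x * y * z) := by
  rcases le_total x y with h1 | h1 <;> rcases le_total y z with h2 | h2 <;>
    rcases le_total x z with h3 | h3 <;>
    nlinarith [mul_nonneg hx (sq_nonneg (y - z)), mul_nonneg hy (sq_nonneg (x - z)),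
      mul_nonneg hz (sq_nonneg (x - y)), mul_nonneg (sub_nonneg.2 h1) (sub_nonneg.2 h2),
      mul_nonneg (sub_nonneg.2 h1) (sub_nonneg.2 h3), mul_nonneg (sub_nonneg.2 h2) (sub_nonneg.2 h3),
      mul_nonneg hx (mul_nonneg (sub_nonneg.2 h1) (sub_nonneg.2 h3)),
      mul_nonneg hz (mul_nonneg (sub_nonneg.2 h2) (sub_nonneg.2 h3)),
      mul_nonneg hy (mul_nonneg (sub_nonneg.2 h1) (sub_nonneg.2 h2)),
      mul_nonneg (add_nonneg hx hy) (sq_nonneg (x - y)),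
      mul_nonneg (add_nonneg hy hz) (sq_nonneg (y - z)),
      mul_nonneg (add_nonneg hx hz) (sq_nonneg (x - z))]

theorem heron_cube_le {x y z t : ℝ} (hx : 0 ≤ x) (hy : 0 ≤ y) (hz : 0 ≤ z) (ht : 0 ≤ t)
    (h : t ≤ 2 * (x * y + y * z + z * x) - x ^ 2 - y ^ 2 - z ^ 2) :
    t ^ 3 ≤ 27 * (x * y * z) ^ 2 := by
  have hS : 0 ≤ x + y + z := by positivity
  have h1 : t * (x + y + z) ≤ 9 * (x * y * z) :=
    (mul_le_mul_of_nonneg_right h hS).trans (schur_cubic hx hy hz)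
  have h2 : 3 * t ≤ (x + y + z) ^ 2 := by
    nlinarith [sq_nonneg (x - y), sq_nonneg (y - z), sq_nonneg (x - z)]
  have h3 : (t * (x + y + z)) ^ 2 ≤ (9 * (x * y * z)) ^ 2 :=
    pow_le_pow_left₀ (by positivity) h1 2
  have h4 := mul_le_mul_of_nonneg_left h2 (sq_nonneg t)
  nlinarith

namespace EinsteinSystem

variable {m A B C D E F X Y Z W G p y w z g : ℝ}

theorem coupling_mul (h : EinsteinSystem m A B C D E F X Y Z W G p y w z g) :
    2 * (A * p * (Y * Z - W * G)) = y ^ 2 + g ^ 2 + z ^ 2 + w ^ 2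
      + (A - C) ^ 2 * (Y ^ 2 + G ^ 2) + (A - B) ^ 2 * (W ^ 2 + Z ^ 2) := by
  linear_combination -(Y * h.OY + Z * h.OZ + W * h.OW + G * h.OG) - y * h.hy - z * h.hz
    - w * h.hw - g * h.hg

theorem sum_vertical (h : EinsteinSystem m A B C D E F X Y Z W G p y w z g) :
    2 * (A * B + B * C + C * A) - A ^ 2 - B ^ 2 - C ^ 2 =
      3 * m - (p ^ 2 + (y ^ 2 + g ^ 2 + z ^ 2 + w ^ 2)) := by
  linear_combination -(h.V1 + h.V2 + h.V3)

theorem sum_horizontal (h : EinsteinSystem m A B C D E F X Y Z W G p y w z g) :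
    2 * (D * E + E * F + F * D) - D ^ 2 - E ^ 2 - F ^ 2 =
      3 * m + 2 * (p ^ 2 + (y ^ 2 + g ^ 2 + z ^ 2 + w ^ 2)) + (B - C) ^ 2 * X ^ 2
      + (A - C) ^ 2 * (Y ^ 2 + G ^ 2) + (A - B) ^ 2 * (W ^ 2 + Z ^ 2) := by
  linear_combination -(h.H1 + h.H2 + h.H3)

theorem heron_vertical_le (h : EinsteinSystem m A B C D E F X Y Z W G p y w z g)
    (hm : 0 < m) (hm2 : m ^ 2 = 4 / 3) :
    2 * (A * B + B * C + C * A) - A ^ 2 - B ^ 2 - C ^ 2 ≤ (9 * m - 6) / 4 := by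
  have hm1 : 1.15 < m := by nlinarith
  have hm3 : m < 1.16 := by nlinarith
  have hs := h.sum_vertical
  have hh := h.sum_horizontal
  set f := 2 * (A * B + B * C + C * A) - A ^ 2 - B ^ 2 - C ^ 2 with hf
  have hα : 0 ≤ p ^ 2 + (y ^ 2 + g ^ 2 + z ^ 2 + w ^ 2) := by positivity
  clear_value f
  rcases le_or_gt f 0 with hf0 | hf0
  · linarith
  have hh2 : 9 * m - 2 * f ≤ 2 * (D * E + E * F + F * D) - D ^ 2 - E ^ 2 - F ^ 2 := by
    have : 0 ≤ (B - C) ^ 2 * X ^ 2 + (A - C) ^ 2 * (Y ^ 2 + G ^ 2)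
      + (A - B) ^ 2 * (W ^ 2 + Z ^ 2) := by positivity
    linarith
  have c1 := heron_cube_le h.hA.le h.hB.le h.hC.le hf0.le hf.le
  have c2 := heron_cube_le h.hD.le h.hE.le h.hF.le (by linarith) hh2
  have hprod : (A * B * C) ^ 2 * (D * E * F) ^ 2 = 1 := by
    linear_combination (A * B * C * D * E * F + 1) * h.vol
  have hle : (f * (9 * m - 2 * f)) ^ 3 ≤ 9 ^ 3 := by
    have h9 : 0 ≤ 9 * m - 2 * f := by linarith
    calc (f * (9 * m - 2 * f)) ^ 3 = f ^ 3 * (9 * m - 2 * f) ^ 3 := mul_pow _ _ _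
      _ ≤ 27 * (A * B * C) ^ 2 * (27 * (D * E * F) ^ 2) :=
        mul_le_mul c1 c2 (by positivity) (by positivity)
      _ = 9 ^ 3 := by linear_combination 27 ^ 2 * hprod
  have h9 : f * (9 * m - 2 * f) ≤ 9 := le_of_pow_le_pow_left₀ (by norm_num) (by norm_num) hle
  by_contra! hc
  nlinarith [mul_pos (sub_pos.2 hc) (show 0 < (9 * m + 6) / 4 - f by linarith)]

theorem volume_le (h : EinsteinSystem m A B C D E F X Y Z W G p y w z g)
    (hm : 0 < m) (hm2 : m ^ 2 = 4 / 3) : A * B * C ≤ 0.2215 := by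
  have hm1 : 1.1547 < m := by nlinarith
  have hs := h.sum_vertical
  have hh := h.sum_horizontal
  have hf := h.heron_vertical_le hm hm2
  have hh2 : 8.196 ≤ 2 * (D * E + E * F + F * D) - D ^ 2 - E ^ 2 - F ^ 2 := by
    have : 0 ≤ (B - C) ^ 2 * X ^ 2 + (A - C) ^ 2 * (Y ^ 2 + G ^ 2)
      + (A - B) ^ 2 * (W ^ 2 + Z ^ 2) := by positivity
    linarith
  have c2 := heron_cube_le h.hD.le h.hE.le h.hF.le (by norm_num) hh2
  have hprod : (A * B * C) ^ 2 * (D * E * F) ^ 2 = 1 := by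
    linear_combination (A * B * C * D * E * F + 1) * h.vol
  by_contra! hc
  have h1 : (0.2215 : ℝ) ^ 2 ≤ (A * B * C) ^ 2 := pow_le_pow_left₀ (by norm_num) hc.le 2
  have h2 := mul_le_mul_of_nonneg_right h1 (sq_nonneg (D * E * F))
  norm_num at c2 h2
  nlinarith

theorem p_mul_X_pos (h : EinsteinSystem m A B C D E F X Y Z W G p y w z g)
    (hm : 0 < m) (hm2 : m ^ 2 = 4 / 3) : 0 < p * X := by
  have hm1 : m < 1.16 := by nlinarith
  have hs := h.sum_vertical
  have hf := h.heron_vertical_le hm hm2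
  have hc := h.coupling_mul
  have h0 : 0 ≤ (A - C) ^ 2 * (Y ^ 2 + G ^ 2) + (A - B) ^ 2 * (W ^ 2 + Z ^ 2) := by positivity
  have h1 : 2 * (D * (p * X)) = 2 * p ^ 2 + 2 * (A * p * (Y * Z - W * G)) := by
    linear_combination -2 * p * h.hp
  have h2 : 0 < D * (p * X) := by nlinarith [sq_nonneg p]
  exact (mul_pos_iff_of_pos_left h.hD).1 h2

end EinsteinSystem

/-- Positivity of the smallest-base quadratic in the range `2 * B ≤ p`. -/
theorem quadratic_pos_of_two_mul_le {m A B C p : ℝ} (hm1 : 1.1547 < m) (hA : 0 < A) (hAC : A ≤ C)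
    (hCB : C ≤ B) (hvol : A * B * C ≤ 0.2215) (hp : 2 * B ≤ p) :
    0 < 3 * m + 2 * p ^ 2 - 2 * (2 * A + B + C) * p + 4 * (B - A) * (C - A) := by
  have h0 : 16 * (A * B) - 4 * B ^ 2 - 4 * A ^ 2 < 3.46 := by
    rcases le_total A 0.53 with h | h
    · nlinarith [sq_nonneg (B - 2 * A)]
    · have h1 : A ^ 2 * B ≤ 0.2215 := by nlinarith [mul_pos hA (hA.trans_le (hAC.trans hCB))]
      have hBA := hAC.trans hCB
      have h2 : A * A ^ 2 ≤ 0.2215 := by nlinarith [sq_nonneg A]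
      have h3 : A ≤ 0.61 := by
        by_contra! hc
        have := pow_le_pow_left₀ (by norm_num) hc.le 3
        norm_num at this; nlinarith
      have h4 : B ≤ 0.79 := by nlinarith
      nlinarith
  nlinarith [mul_nonneg (sub_nonneg.2 hp) (show 0 ≤ p - (A + C) by linarith),
    mul_le_mul_of_nonneg_left hCB hA.le, mul_nonneg (sub_nonneg.2 hp) (show 0 ≤ p - B by linarith)]

/-- Positivity of the smallest-base cubic for small `N`. -/
theorem cubic_pos_small {m A N p : ℝ} (hm1 : 1.1547 < m) (hA : 0 < A) (hAN : A ≤ N)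
    (hN : N ≤ 1.0746) (hvol : A ^ 2 * N ≤ 0.2215) (hp : N ≤ p) :
    0 < p ^ 3 - 2 * (N + 3 * A) * p ^ 2 + (N ^ 2 - 6 * A * N + 8 * m) * p
      - 4 * (m - A * N) * N := by
  obtain ⟨x, rfl⟩ : ∃ x, p = N + x := ⟨p - N, by ring⟩
  have hx : 0 ≤ x := by linarith
  have hN0 : 0 < N := by linarith
  have key : 0 < x ^ 3 + (N - 6 * A) * x ^ 2 + (8 * m - 18 * A * N) * x + 4 * N * (m - 2 * A * N) := by
    rcases le_total N 0.61 with h | h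
    · have e1 : (N - 6 * A) * x ^ 2 ≥ (- 5 * N) * x ^ 2 := by nlinarith [sq_nonneg x]
      have e2 : A * N ≤ N * N := by nlinarith
      have e3 : (8 * m - 18 * A * N) * x ≥ (8 * m - 18 * (N * N)) * x := by nlinarith
      have e4 : 4 * N * (m - 2 * A * N) ≥ 4 * N * (m - 2 * (N * N)) := by nlinarith
      have e5 : 0 < 4 * N * (m - 2 * (N * N)) := by
        apply mul_pos (by linarith); nlinarith
      have e6 : 0 ≤ x * (8 * m - 24.25 * N ^ 2) := mul_nonneg hx (by nlinarith)
      nlinarith [mul_nonneg hx (sq_nonneg (x - 2.5 * N))]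
    · have hAle : A ≤ 0.8 - 0.32 * N := by
        by_contra! hc
        have q : (0.8 - 0.32 * N) ^ 2 < A ^ 2 := by nlinarith
        have q1 : (0.8 - 0.32 * N) ^ 2 * N ≥ 0.2215 := by
          nlinarith [mul_nonneg (sub_nonneg.2 h) (sub_nonneg.2 hN),
            mul_nonneg (mul_nonneg (sub_nonneg.2 h) (sub_nonneg.2 hN)) hN0.le]
        nlinarith
      have e1 : (N - 6 * A) * x ^ 2 ≥ (N - 6 * (0.8 - 0.32 * N)) * x ^ 2 := by nlinarith [sq_nonneg x]
      have e2 : A * N ≤ (0.8 - 0.32 * N) * N := by nlinarith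
      have e3 : (8 * m - 18 * A * N) * x ≥ (8 * 1.1547 - 18 * ((0.8 - 0.32 * N) * N)) * x := by nlinarith
      have e4 : 4 * N * (m - 2 * A * N) ≥ 4 * N * (1.1547 - 2 * ((0.8 - 0.32 * N) * N)) := by nlinarith
      have e5 : 0.7 < 4 * N * (1.1547 - 2 * ((0.8 - 0.32 * N) * N)) := by
        nlinarith [mul_nonneg (sub_nonneg.2 h) (sub_nonneg.2 hN), mul_nonneg hN0.le (sq_nonneg (N - 1))]
      have e6 : 0 ≤ x * (3.4776 - 7.392 * N + 3.6284 * N ^ 2 + 0.29) := mul_nonneg hx (by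
        have := sq_nonneg (N - 1.018)
        linarith)
      have e7 := mul_nonneg hx (sq_nonneg (x - (2.4 - 1.46 * N)))
      rcases le_total x 2.4 with hx2 | hx2
      · linarith
      · have e8 : 0.6 ≤ (x - (2.4 - 1.46 * N)) ^ 2 := by
          have : 0.89 ≤ x - (2.4 - 1.46 * N) := by linarith
          have := mul_self_le_mul_self (by norm_num) this
          linarith
        have e9 := mul_le_mul_of_nonneg_left e8 hx
        linarith
  linarith [key]

theorem lt_of_sq_mul_le {A N a c : ℝ} (hN : 0 < N) (ha : 0 ≤ a) (h : A ^ 2 * N ≤ c)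
    (hc : c ≤ a ^ 2 * N) : A ≤ a := by
  by_contra! h1
  have := mul_lt_mul_of_pos_right (pow_lt_pow_left₀ h1 ha two_ne_zero) hN
  linarith

theorem le_of_mul_le_mul_bound {e N b c : ℝ} (hN : 0 < N) (h : e * N ≤ c) (hc : c ≤ b * N) :
    e ≤ b := le_of_mul_le_mul_right (h.trans hc) hN

theorem low_range_pos {m A N p : ℝ} (hm1 : 1.1547 < m)
    (hA : 0 < A) (hN : 1.07 ≤ N) (hvol : A ^ 2 * N ≤ 0.2215) (hp0 : 0 < p)
    (hp : p ≤ 1.28 ∨ 1.6 ≤ N ∧ p ≤ 1.48) :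
    0 < (p - N) ^ 2 - 6 * A * (p + N) + 4 * A * N + 4 * m := by
  rcases le_total N 1.6 with h | h
  · have ha : A ≤ 0.6245 - 0.157 * N := by
      apply lt_of_sq_mul_le (by linarith) (by linarith) hvol
      nlinarith [mul_nonneg (sub_nonneg.2 hN) (sub_nonneg.2 h),
        mul_nonneg (mul_nonneg (sub_nonneg.2 hN) (sub_nonneg.2 h)) hp0.le]
    have h1 : A * (6 * p + 2 * N) ≤ (0.6245 - 0.157 * N) * (6 * p + 2 * N) :=
      mul_le_mul_of_nonneg_right ha (by linarith)
    have h2 : p ≤ 1.48 := by rcases hp with hp | hp <;> linarith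
    rcases hp with hp | ⟨hp, hp'⟩
    · nlinarith [mul_nonneg (sub_nonneg.2 hp) (sub_nonneg.2 hN), sq_nonneg (p - N)]
    · have : N = 1.6 := le_antisymm h hp
      subst this
      nlinarith
  · have ha : A ≤ 0.3721 := by
      apply lt_of_sq_mul_le (by linarith) (by norm_num) hvol
      nlinarith
    have h1 : A * (6 * p + 2 * N) ≤ 0.3721 * (6 * p + 2 * N) :=
      mul_le_mul_of_nonneg_right ha (by linarith)
    have h2 : p ≤ 1.48 := by rcases hp with hp | hp <;> linarith
    nlinarith [sq_nonneg (N - 1.85), mul_nonneg (sub_nonneg.2 h2) (sub_nonneg.2 h)]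

theorem mid_range_pos {m A N e p : ℝ} (hm1 : 1.1547 < m) (hm2 : m < 1.15471)
    (hA : 0 < A) (hN : 1.07 ≤ N) (hN2 : N ≤ 1.6) (hvol : A ^ 2 * N ≤ 0.2215) (he : e * N ≤ m)
    (hp1 : 1.28 ≤ p) (hp2 : p ≤ 1.48) :
    0 < p ^ 2 - 2 * (N + 3 * A) * p + N ^ 2 - 6 * A * N + 8 * m
      - 4 * (m - A * N) * ((N + e) * (25 / 64)) := by
  have ha : A ≤ 0.6245 - 0.157 * N := by
    apply lt_of_sq_mul_le (by linarith) (by linarith) hvol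
    nlinarith [mul_nonneg (sub_nonneg.2 hN) (sub_nonneg.2 hN2),
        mul_nonneg (mul_nonneg (sub_nonneg.2 hN) (sub_nonneg.2 hN2)) hA.le]
  have hb : e ≤ 1.8012 - 0.6746 * N := by
    apply le_of_mul_le_mul_bound (by linarith) he
    nlinarith [mul_nonneg (sub_nonneg.2 hN) (sub_nonneg.2 hN2)]
  have hM : 0 ≤ m - A * N := by nlinarith
  have h1 := mul_le_mul_of_nonneg_left hb hM
  have h2 : A * (6 * p + 6 * N - 4 * N * ((1.8012 + 0.3254 * N) * (25 / 64))) ≤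
      (0.6245 - 0.157 * N) * (6 * p + 6 * N - 4 * N * ((1.8012 + 0.3254 * N) * (25 / 64))) :=
    mul_le_mul_of_nonneg_right ha (by nlinarith)
  have h3 : 0 < p ^ 2 - 2 * N * p + N ^ 2 + 8 * m - 4 * m * ((1.8012 + 0.3254 * N) * (25 / 64))
      - (0.6245 - 0.157 * N) * (6 * p + 6 * N - 4 * N * ((1.8012 + 0.3254 * N) * (25 / 64))) := by
    have k1 : 0 ≤ (1.48 - p) * (2 * N + 6 * (0.6245 - 0.157 * N) - 1.48 - p) :=
      mul_nonneg (by linarith) (by linarith)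
    have k2 : 0 ≤ (m - 1.1547) * (8 - 4 * ((1.8012 + 0.3254 * N) * (25 / 64))) :=
      mul_nonneg (by linarith) (by linarith)
    have k3 := mul_nonneg (sub_nonneg.2 hN) (sub_nonneg.2 hN2)
    have k4 : 0 ≤ (N - 1.07) * (1.6 - N) * N := mul_nonneg k3 (by linarith)
    nlinarith
  linarith

theorem high_range_pos {m A N e : ℝ} (hm1 : 1.1547 < m) (hm2 : m < 1.15471)
    (hA : 0 < A) (hN : 1.07 ≤ N) (hN2 : N ≤ 1.9) (hvol : A ^ 2 * N ≤ 0.2215) (he : e * N ≤ m)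
    (hAe : A ≤ e) :
    0 < 6.5 * m + N ^ 2 / 3 - 9 * A * N - 5.5 * A ^ 2 - (e - A) ^ 2 / 2
      - 4 * (m - A * N) * ((N + e) * (25 / 74)) := by
  have main : ∀ a b : ℝ, A ≤ a → e ≤ b → b ≤ N + 0.01 → b ≤ 2 → a ≤ 1 →
      0 < 6.5 * m + N ^ 2 / 3 - 9 * a * N - 5.5 * a ^ 2 - (b - a) ^ 2 / 2
      - 4 * (m - a * N) * ((N + b) * (25 / 74)) → 0 < 6.5 * m + N ^ 2 / 3 - 9 * A * N
      - 5.5 * A ^ 2 - (e - A) ^ 2 / 2 - 4 * (m - A * N) * ((N + e) * (25 / 74)) := by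
    intro a b ha hb hb1 hb2 _ h
    have hM : 0 ≤ m - A * N := by nlinarith
    have h1 := mul_le_mul_of_nonneg_left hb hM
    have h2 : (e - A) ^ 2 ≤ (b - A) ^ 2 := pow_le_pow_left₀ (by linarith) (by linarith) 2
    have h3 : 0 ≤ (a - A) * (9 * N + 6 * (a + A) - b - 4 * N * ((N + b) * (25 / 74))) :=
      mul_nonneg (by linarith) (by nlinarith)
    linarith
  have hm' : ∀ t, 0 ≤ t → t ≤ 2 → (6.5 - 4 * t) * m ≥ 6.5 * 1.1547 - 4 * t * 1.15471 := by
    intro t _ _; nlinarith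
  rcases le_total N 1.6 with h | h
  · refine main (0.6245 - 0.157 * N) (1.8012 - 0.6746 * N) ?_ ?_ ?_ ?_ ?_ ?_
    · apply lt_of_sq_mul_le (by linarith) (by linarith) hvol
      nlinarith [mul_nonneg (sub_nonneg.2 hN) (sub_nonneg.2 h),
        mul_nonneg (mul_nonneg (sub_nonneg.2 hN) (sub_nonneg.2 h)) hA.le]
    · apply le_of_mul_le_mul_bound (by linarith) he
      nlinarith [mul_nonneg (sub_nonneg.2 hN) (sub_nonneg.2 h)]
    · linarith
    · linarith
    · linarith
    · have k3 := mul_nonneg (sub_nonneg.2 hN) (sub_nonneg.2 h)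
      have k4 : 0 ≤ (N - 1.07) * (1.6 - N) * N := mul_nonneg k3 (by linarith)
      have := hm' ((N + (1.8012 - 0.6746 * N)) * (25 / 74)) (by linarith) (by linarith)
      nlinarith
  · refine main (0.5365 - 0.1024 * N) (1.33 - 0.38 * N) ?_ ?_ ?_ ?_ ?_ ?_
    · apply lt_of_sq_mul_le (by linarith) (by linarith) hvol
      nlinarith [mul_nonneg (sub_nonneg.2 h) (sub_nonneg.2 hN2),
        mul_nonneg (mul_nonneg (sub_nonneg.2 h) (sub_nonneg.2 hN2)) hA.le]
    · apply le_of_mul_le_mul_bound (by linarith) he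
      nlinarith [mul_nonneg (sub_nonneg.2 h) (sub_nonneg.2 hN2)]
    · linarith
    · linarith
    · linarith
    · have k3 := mul_nonneg (sub_nonneg.2 h) (sub_nonneg.2 hN2)
      have k4 : 0 ≤ (N - 1.6) * (1.9 - N) * N := mul_nonneg k3 (by linarith)
      have := hm' ((N + (1.33 - 0.38 * N)) * (25 / 74)) (by linarith) (by linarith)
      nlinarith

theorem top_range_pos {m A N e : ℝ} (hm1 : 1.1547 < m) (hm2 : m < 1.15471)
    (hA : 0 < A) (hN : 1.9 ≤ N) (hvol : A ^ 2 * N ≤ 0.2215) (he : e * N ≤ m)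
    (hAe : A ≤ e) :
    0 < 2.5 * m + N ^ 2 / 3 - 5 * A * N - 5.5 * A ^ 2 - (e - A) ^ 2 / 2 := by
  have ha : A ≤ 0.3415 := by
    apply lt_of_sq_mul_le (by linarith) (by norm_num) hvol
    nlinarith
  have hb : e ≤ 0.608 := by
    apply le_of_mul_le_mul_bound (by linarith) he
    nlinarith
  have hAN : A * N ≤ 0.1704 * N + 0.325 := by
    have : (A * N) ^ 2 ≤ 0.2215 * N := by nlinarith
    nlinarith [sq_nonneg (A * N - 0.65)]
  rcases le_total A 0.2 with h | h
  · nlinarith [sq_nonneg (N - 1.5)]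
  · have : (e - A) ^ 2 ≤ 0.408 ^ 2 := pow_le_pow_left₀ (by linarith) (by linarith) 2
    nlinarith

theorem quadratic_pos_of_le {c x : ℝ} (hc : 0 ≤ c) (hx : 0 < x)
    (hx1 : 2.04 * x ≤ c ^ 2 + 0.109) : 0 < (c + x) ^ 2 + 1.218 - 4.53 * x := by
  rcases le_total 2.265 c with h | h
  · nlinarith
  · nlinarith [mul_nonneg (sub_nonneg.2 hx1) (sub_nonneg.2 h), mul_nonneg hc (sub_nonneg.2 h),
      sq_nonneg (c - 0.5), mul_nonneg hc (sq_nonneg (c - 0.5)), sq_nonneg x]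

theorem cubic_pos_of_lt {m A B C p : ℝ} (hm1 : 1.1547 < m) (hm2 : m < 1.15471) (hA : 0 < A)
    (hAC : A ≤ C) (hCB : C ≤ B) (hp : 0 < p) (hpB : p < B)
    (hK : 0 ≤ p ^ 2 - m + A ^ 2 - (B - C) ^ 2) (hV2 : B ^ 2 - (C - A) ^ 2 ≤ m)
    (hvol : A * B * C ≤ 0.2215) (hM : 0 ≤ m - A * (B + C - A)) :
    0 < p * ((B + C - A - p) ^ 2 + 4 * m - 6 * A * p - 2 * A * (B + C - A))
      - 4 * (m - A * (B + C - A)) * (B - p) := by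
  have hB : 0 < B := by linarith
  have hC : 0 < C := by linarith
  have h1 : m < A ^ 2 + 2 * (B * C) - C ^ 2 := by nlinarith
  have hA1 : A < 0.39 := by
    have e : 0.577 < B * C := by
      have := mul_self_le_mul_self hA.le hAC
      linarith
    have := mul_lt_mul_of_pos_left e hA
    linarith
  have hC6 : 0.6 ≤ C := by
    by_contra! hc
    have hB1 : B ≤ 1.234 - A / 3 := by
      have e2 : (C - A) ^ 2 ≤ (0.6 - A) ^ 2 := pow_le_pow_left₀ (by linarith) (by linarith) 2
      have e3 : B ^ 2 ≤ (1.234 - A / 3) ^ 2 := by nlinarith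
      exact (pow_le_pow_iff_left₀ hB.le (by linarith) two_ne_zero).1 e3
    have t1 := mul_le_mul_of_nonneg_right hB1 hC.le
    have t2 : 0 ≤ (0.6 - C) * (1.868 - 2 * A / 3 - C) := mul_nonneg (by linarith) (by linarith)
    have t3 : 0 ≤ A * (0.39 - A) := mul_nonneg hA.le (by linarith)
    linarith
  have hA2 : A < 0.33 := by
    have e1 := mul_self_le_mul_self (by norm_num) hC6
    have e2 := mul_self_le_mul_self hA.le hA1.le
    have e : 0.68 < B * C := by linarith
    have := mul_lt_mul_of_pos_left e hA
    linarith
  have hp1 : 1.02 ≤ p := by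
    have : (1.02 : ℝ) ^ 2 ≤ p ^ 2 := by 
      have e2 := mul_self_le_mul_self hA.le hA2.le
      linarith [sq_nonneg (B - C)]
    exact (pow_le_pow_iff_left₀ (by norm_num) hp.le two_ne_zero).1 this
  have hAB : A * B ≤ 0.37 := by
    have := mul_le_mul_of_nonneg_left hC6 (mul_pos hA hB).le
    linarith
  have hAC2 : A * C ≤ 0.2172 := by
    have := mul_le_mul_of_nonneg_left (hp1.trans hpB.le) (mul_pos hA hC).le
    linarith
  have hT : 6 * A * p + 2 * A * (B + C - A) ≤ 3.4 := by
    have := mul_le_mul_of_nonneg_left hpB.le hA.le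
    linarith [mul_pos hA hA]
  obtain ⟨c, rfl⟩ : ∃ c, C = A + c := ⟨C - A, by ring⟩
  obtain ⟨x, rfl⟩ : ∃ x, B = p + x := ⟨B - p, by ring⟩
  have hc : 0 ≤ c := by linarith
  have hx : 0 < x := by linarith
  have hx1 : 2.04 * x ≤ c ^ 2 + 0.109 := by
    have a1 := mul_le_mul_of_nonneg_right hp1 hx.le
    have a2 := mul_self_le_mul_self hA.le hA2.le
    linarith [sq_nonneg (p + x - (A + c)), sq_nonneg x]
  have hb : 0 < (c + x) ^ 2 + 1.218 - 4.53 * x := by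
    exact quadratic_pos_of_le hc hx hx1
  have h5 : 1.02 * ((c + x) ^ 2 + 1.218) ≤ p * ((p + x + (A + c) - A - p) ^ 2 + 4 * m - 6 * A * p
      - 2 * A * (p + x + (A + c) - A)) := by
    apply mul_le_mul hp1 _ (by positivity) hp.le
    have : (p + x + (A + c) - A - p) ^ 2 = (c + x) ^ 2 := by ring
    linarith
  have h6 : 4 * (m - A * (p + x + (A + c) - A)) * (p + x - p) ≤ 4.62 * x := by
    have : 0 ≤ A * (p + x + (A + c) - A) := mul_nonneg hA.le (by linarith)
    have := mul_le_mul_of_nonneg_right (show 4 * (m - A * (p + x + (A + c) - A)) ≤ 4.62 by linarith) hx.le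
    linarith
  linarith

theorem cubic_pos_of_le {m A B C p : ℝ} (hm1 : 1.1547 < m) (hm2 : m < 1.15471) (hA : 0 < A)
    (hAC : A ≤ C) (hCB : C ≤ B) (hpB : B ≤ p)
    (hv : 0 ≤ 3 * m - p ^ 2 - 2 * A * (B + C) + A ^ 2 + (B - C) ^ 2)
    (hV2 : B ^ 2 - (C - A) ^ 2 ≤ m) (hvol : A * B * C ≤ 0.2215) :
    0 < p ^ 3 - 2 * (B + C - A + 3 * A) * p ^ 2
      + ((B + C - A) ^ 2 - 6 * A * (B + C - A) + 8 * m) * p - 4 * (m - A * (B + C - A)) * B := by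
  obtain ⟨N, hN⟩ : ∃ N, N = B + C - A := ⟨_, rfl⟩
  obtain ⟨e, he⟩ : ∃ e, e = A + B - C := ⟨_, rfl⟩
  obtain rfl : B = (N + e) / 2 := by linarith
  obtain rfl : C = (N - e) / 2 + A := by linarith
  have hAe : A ≤ e := by linarith
  have heN : e * N ≤ m := by linarith
  have hN0 : A ≤ N := by linarith
  have hM : 0 ≤ m - A * N := by
    have := mul_le_mul_of_nonneg_right hAe (hA.le.trans hN0)
    linarith
  have hvol2 : A ^ 2 * N ≤ 0.2215 := by
    have : 0 ≤ A * (((N + e) / 2 - A) * ((N - e) / 2)) :=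
      mul_nonneg hA.le (mul_nonneg (by linarith) (by linarith))
    linarith
  have hp : 0 < p := by linarith
  have h1 : 4 * (m - A * N) * ((N + e) / 2) ≤ 4 * (m - A * N) * p :=
    mul_le_mul_of_nonneg_left hpB (by linarith)
  rw [← hN]
  clear hN hvol he
  rcases le_total N 1.0746 with h | h
  · rcases le_total p N with hpN | hpN
    · have hAN : A * N ≤ 0.5 := by
        have : (A * N) ^ 2 ≤ 0.5 ^ 2 := by nlinarith
        exact (pow_le_pow_iff_left₀ (mul_nonneg hA.le (hA.le.trans hN0)) (by norm_num)
          two_ne_zero).1 this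
      have : 0 < p * ((p - N) ^ 2 - 6 * A * (p + N) + 4 * A * N + 4 * m) := by
        apply mul_pos hp
        have := mul_le_mul_of_nonneg_left hpN hA.le
        linarith [sq_nonneg (p - N)]
      linarith
    · have := cubic_pos_small hm1 hA hN0 h hvol2 hpN
      have h2 : 4 * (m - A * N) * ((N + e) / 2) ≤ 4 * (m - A * N) * N :=
        mul_le_mul_of_nonneg_left (by linarith) (by linarith)
      linarith
  have hN1 : 1.07 ≤ N := by linarith
  by_cases hlow : p ≤ 1.28 ∨ 1.6 ≤ N ∧ p ≤ 1.48
  · have := mul_pos hp (low_range_pos hm1 hA hN1 hvol2 hp hlow)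
    linarith
  have hMB : 0 ≤ 4 * (m - A * N) * ((N + e) / 2) := mul_nonneg (by linarith) (by linarith)
  rcases le_total p 1.48 with h2 | h2
  · have h3 : 1.28 ≤ p := by by_contra! h3; exact hlow (Or.inl h3.le)
    have h4 : N ≤ 1.6 := by by_contra! h4; exact hlow (Or.inr ⟨h4.le, h2⟩)
    have := mul_pos hp (mid_range_pos hm1 hm2 hA hN1 h4 hvol2 heN h3 h2)
    have := mul_le_mul_of_nonneg_left h3 hMB
    linarith
  · have hsq : 0 ≤ p * (p - 2 / 3 * (N + 3 * A)) ^ 2 := by positivity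
    have hpv := mul_nonneg hp.le hv
    rcases le_total N 1.9 with h3 | h3
    · have := mul_pos hp (high_range_pos hm1 hm2 hA hN1 h3 hvol2 heN hAe)
      have := mul_le_mul_of_nonneg_left h2 hMB
      linarith
    · have := mul_pos hp (top_range_pos hm1 hm2 hA h3 hvol2 heN hAe)
      linarith

theorem smallest_base_estimate {m A B C p v τ : ℝ} (hm1 : 1.1547 < m) (hm2 : m < 1.15471)
    (hA : 0 < A) (hAC : A ≤ C) (hCB : C ≤ B) (hp : 0 < p) (hv : 0 ≤ v) (hτ : 0 ≤ τ)
    (hvd : v = 3 * m - p ^ 2 - 2 * A * (B + C) + A ^ 2 + (B - C) ^ 2)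
    (hK : τ ≤ p ^ 2 - m + A ^ 2 - (B - C) ^ 2) (hV2 : B ^ 2 - (C - A) ^ 2 ≤ m)
    (hvol : A * B * C ≤ 0.2215) :
    0 < p * (3 * m + 2 * p ^ 2 - 2 * (2 * A + B + C) * p + 4 * (B - A) * (C - A))
      + 2 * v * (p - B) - τ * (2 * B - p) := by
  rcases le_total (2 * B) p with h | h
  · have h1 := mul_pos hp (quadratic_pos_of_two_mul_le hm1 hA hAC hCB hvol h)
    have h2 : 0 ≤ v * (p - B) := mul_nonneg hv (by linarith)
    have h3 : 0 ≤ τ * (p - 2 * B) := mul_nonneg hτ (by linarith)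
    linarith
  · have h1 := mul_le_mul_of_nonneg_right hK (sub_nonneg.2 h)
    rcases le_or_gt B p with h2 | h2
    · have := cubic_pos_of_le hm1 hm2 hA hAC hCB h2 (hvd ▸ hv) hV2 hvol
      subst hvd
      linarith
    · have hM : 0 ≤ m - A * (B + C - A) := by
        have : 0 ≤ (B - C) * (B + C - A) := mul_nonneg (by linarith) (by linarith)
        linarith
      have := cubic_pos_of_lt hm1 hm2 hA hAC hCB hp h2 (hτ.trans hK) hV2 hvol hM
      subst hvd
      linarith

theorem mul_eq_sq_of_coupled {a b θ u v : ℝ} (h1 : a * u = θ * v) (h2 : b * v = θ * u)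
    (hne : u ≠ 0 ∨ v ≠ 0) : a * b = θ ^ 2 := by
  rcases hne with hu | hv
  · apply mul_right_cancel₀ hu
    linear_combination b * h1 + θ * h2
  · apply mul_right_cancel₀ hv
    linear_combination a * h2 + θ * h1

theorem le_of_coupled {a b θ r u v : ℝ} (hθ : 0 ≤ θ) (h1 : a * u = θ * v)
    (h2 : b * v = θ * u) (hr : r ^ 2 ≤ a * b) (hne : u ≠ 0 ∨ v ≠ 0) : r ≤ θ := by
  rw [mul_eq_sq_of_coupled h1 h2 hne] at hr
  exact (le_abs_self r).trans (abs_le_of_sq_le_sq hr hθ)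

namespace EinsteinSystem

variable {m A B C D E F X Y Z W G p y w z g : ℝ}

theorem block_Y (h : EinsteinSystem m A B C D E F X Y Z W G p y w z g) :
    (E ^ 2 + C ^ 2 * X ^ 2 + (A - C) ^ 2) * Y = (A * p + X * (B * E + C * F)) * Z := by
  linear_combination h.OY - E * h.hy + C * X * h.hz

theorem block_Z (h : EinsteinSystem m A B C D E F X Y Z W G p y w z g) :
    (F ^ 2 + B ^ 2 * X ^ 2 + (A - B) ^ 2) * Z = (A * p + X * (B * E + C * F)) * Y := by
  linear_combination h.OZ - F * h.hz + B * X * h.hy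

theorem block_W (h : EinsteinSystem m A B C D E F X Y Z W G p y w z g) :
    (E ^ 2 + B ^ 2 * X ^ 2 + (A - B) ^ 2) * W = (A * p + X * (C * E + B * F)) * -G := by
  linear_combination h.OW - E * h.hw - B * X * h.hg

theorem block_G (h : EinsteinSystem m A B C D E F X Y Z W G p y w z g) :
    (F ^ 2 + C ^ 2 * X ^ 2 + (A - C) ^ 2) * -G = (A * p + X * (C * E + B * F)) * W := by
  linear_combination -h.OG + F * h.hg + C * X * h.hw

theorem D_mul_X_mul_p (h : EinsteinSystem m A B C D E F X Y Z W G p y w z g) :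
    D * X * p = p ^ 2 + A * p * (Y * Z - W * G) := by
  linear_combination -p * h.hp

theorem D_mul_excess (h : EinsteinSystem m A B C D E F X Y Z W G p y w z g) :
    D * (E + F - D) = m + p ^ 2 + A * p * (Y * Z - W * G) := by
  linear_combination -(h.H2 + h.H3) / 2 - h.coupling_mul / 2

theorem four_mul_E_mul_F (h : EinsteinSystem m A B C D E F X Y Z W G p y w z g) :
    4 * (E * F) = 2 * (m + p ^ 2 + A * p * (Y * Z - W * G)) + (E + F - D) ^ 2 + m
      + (y ^ 2 + g ^ 2 + z ^ 2 + w ^ 2) + (B - C) ^ 2 * X ^ 2 := by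
  linear_combination -h.H1 - h.H2 - h.H3 - h.coupling_mul

theorem coupling_nonneg (h : EinsteinSystem m A B C D E F X Y Z W G p y w z g) :
    0 ≤ A * p * (Y * Z - W * G) := by
  have h1 := h.coupling_mul
  have : 0 ≤ y ^ 2 + g ^ 2 + z ^ 2 + w ^ 2
      + (A - C) ^ 2 * (Y ^ 2 + G ^ 2) + (A - B) ^ 2 * (W ^ 2 + Z ^ 2) := by positivity
  linarith

theorem excess_pos (h : EinsteinSystem m A B C D E F X Y Z W G p y w z g) (hm : 0 < m) :
    0 < E + F - D := by
  have h1 := h.D_mul_excess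
  have h2 := h.coupling_nonneg
  have : 0 < D * (E + F - D) := by nlinarith [sq_nonneg p]
  exact (mul_pos_iff_of_pos_left h.hD).1 this

theorem abs_sub_mul_excess_le (h : EinsteinSystem m A B C D E F X Y Z W G p y w z g)
    (hm : 0 < m) : |E - F| * (E + F - D) ≤ A * p * (Y * Z - W * G) := by
  have h1 := h.coupling_mul
  have h2 : 2 * ((E - F) * (E + F - D)) = (z ^ 2 + g ^ 2) - (y ^ 2 + w ^ 2)
      + (A - B) ^ 2 * (W ^ 2 - Z ^ 2) + (A - C) ^ 2 * (Y ^ 2 - G ^ 2) := by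
    linear_combination h.H3 - h.H2
  have hx := h.excess_pos hm
  have hW : 0 ≤ (A - B) ^ 2 * W ^ 2 := by positivity
  have hZ : 0 ≤ (A - B) ^ 2 * Z ^ 2 := by positivity
  have hY : 0 ≤ (A - C) ^ 2 * Y ^ 2 := by positivity
  have hG : 0 ≤ (A - C) ^ 2 * G ^ 2 := by positivity
  have : |(E - F) * (E + F - D)| ≤ A * p * (Y * Z - W * G) := by
    rw [abs_le]
    constructor <;> linarith [sq_nonneg y, sq_nonneg z, sq_nonneg w, sq_nonneg g]
  rwa [abs_mul, abs_of_pos hx] at this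

theorem X_mul_p_mul_abs_le (h : EinsteinSystem m A B C D E F X Y Z W G p y w z g)
    (hm : 0 < m) : X * p * |E - F| ≤ A * p * (Y * Z - W * G) := by
  have h1 := h.D_mul_X_mul_p
  have h2 := h.D_mul_excess
  have h3 := h.coupling_nonneg
  have h4 := h.abs_sub_mul_excess_le hm
  have hx := h.excess_pos hm
  set V := A * p * (Y * Z - W * G)
  have hQ : 0 < m + p ^ 2 + V := by positivity
  refine le_of_mul_le_mul_right ?_ hQ
  calc X * p * |E - F| * (m + p ^ 2 + V) = (p ^ 2 + V) * (|E - F| * (E + F - D)) := by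
        rw [← h1, ← h2]; ring
    _ ≤ (p ^ 2 + V) * V := mul_le_mul_of_nonneg_left h4 (by positivity)
    _ ≤ V * (m + p ^ 2 + V) := by nlinarith

theorem block_ne_zero (h : EinsteinSystem m A B C D E F X Y Z W G p y w z g)
    (hpX : 0 < p * X) : (Y ≠ 0 ∨ Z ≠ 0) ∨ (W ≠ 0 ∨ -G ≠ 0) := by
  by_contra! hc
  obtain ⟨⟨rfl, rfl⟩, rfl, hG⟩ := hc
  obtain rfl : G = 0 := by linarith
  have h1 : D * (p * X) + (B - C) ^ 2 * X ^ 2 = 0 := by linear_combination X * h.OX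
  have := mul_pos h.hD hpX
  nlinarith [sq_nonneg ((B - C) * X)]

/-- Cauchy–Schwarz for the nonzero coupling block. -/
theorem cauchy_schwarz (h : EinsteinSystem m A B C D E F X Y Z W G p y w z g)
    (hp : 0 < p) (hX : 0 < X) :
    4 * (E * F + B * C * X ^ 2 + |(A - B) * (A - C)|) ≤
      4 * A * p + 2 * X * ((B + C) * (E + F) + |B - C| * |E - F|) := by
  have hA := h.hA
  have hB := h.hB
  have hC := h.hC
  have hE := h.hE
  have hF := h.hF
  have habs : |(A - B) * (A - C)| ^ 2 = (A - B) ^ 2 * (A - C) ^ 2 := by rw [sq_abs]; ring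
  have h1 : 2 * |(A - B) * (A - C)| * (E * F + B * C * X ^ 2) ≤
      (E ^ 2 + C ^ 2 * X ^ 2) * (A - B) ^ 2 + (F ^ 2 + B ^ 2 * X ^ 2) * (A - C) ^ 2 := by
    have e1 := sq_nonneg (E * |A - B| - F * |A - C|)
    have e2 := sq_nonneg (C * X * |A - B| - B * X * |A - C|)
    rw [abs_mul]
    have e3 := sq_abs (A - B)
    have e4 := sq_abs (A - C)
    rw [← e3, ← e4]
    linarith
  have h2 : 2 * |(A - B) * (A - C)| * (E * F + B * C * X ^ 2) ≤
      (F ^ 2 + C ^ 2 * X ^ 2) * (A - B) ^ 2 + (E ^ 2 + B ^ 2 * X ^ 2) * (A - C) ^ 2 := by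
    have e1 := sq_nonneg (F * |A - B| - E * |A - C|)
    have e2 := sq_nonneg (C * X * |A - B| - B * X * |A - C|)
    rw [abs_mul]
    have e3 := sq_abs (A - B)
    have e4 := sq_abs (A - C)
    rw [← e3, ← e4]
    linarith
  have h3 : |(B - C) * (E - F)| = |B - C| * |E - F| := abs_mul _ _
  rcases h.block_ne_zero (mul_pos hp hX) with hne | hne
  · have := le_of_coupled (r := E * F + B * C * X ^ 2 + |(A - B) * (A - C)|) (by positivity)
      h.block_Y h.block_Z (by nlinarith [sq_nonneg (E * B * X - F * C * X)]) hne
    have := mul_le_mul_of_nonneg_left (le_abs_self ((B - C) * (E - F))) hX.le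
    rw [h3] at this
    linarith
  · have := le_of_coupled (r := E * F + B * C * X ^ 2 + |(A - B) * (A - C)|) (by positivity)
      h.block_W h.block_G (by nlinarith [sq_nonneg (E * C * X - F * B * X)]) hne
    have := mul_le_mul_of_nonneg_left (neg_abs_le ((B - C) * (E - F))) hX.le
    rw [h3] at this
    linarith

theorem false_of_ordered (h : EinsteinSystem m A B C D E F X Y Z W G p y w z g)
    (hm : 0 < m) (hm2 : m ^ 2 = 4 / 3) (hp : 0 < p) (hX : 0 < X) (hAC : A ≤ C) (hCB : C ≤ B) :
    False := by
  have hm1 : 1.1547 < m := by nlinarith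
  have hm3 : m < 1.15471 := by nlinarith
  have hA := h.hA
  have hB := h.hB
  have hC := h.hC
  have hW : 0 ≤ (B - A) * (W ^ 2 + Z ^ 2) := mul_nonneg (by linarith) (by positivity)
  have hY : 0 ≤ (C - A) * (Y ^ 2 + G ^ 2) := mul_nonneg (by linarith) (by positivity)
  have hW1 : 0 ≤ (A + B) * ((B - A) * (W ^ 2 + Z ^ 2)) := mul_nonneg (by linarith) hW
  have hW2 : 0 ≤ A * ((B - A) * (W ^ 2 + Z ^ 2)) := mul_nonneg hA.le hW
  have hY2 : 0 ≤ A * ((C - A) * (Y ^ 2 + G ^ 2)) := mul_nonneg hA.le hY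
  have hX2 : 0 ≤ (B - C) * ((B + C) * X ^ 2) := mul_nonneg (by linarith) (by positivity)
  obtain ⟨v, hv⟩ : ∃ v, v = y ^ 2 + g ^ 2 + z ^ 2 + w ^ 2 := ⟨_, rfl⟩
  obtain ⟨τ, hτ⟩ : ∃ τ, τ = (A - C) ^ 2 * (Y ^ 2 + G ^ 2) + (A - B) ^ 2 * (W ^ 2 + Z ^ 2) :=
    ⟨_, rfl⟩
  have hsum := h.sum_vertical
  have hc := h.coupling_mul
  have est := smallest_base_estimate (v := v) (τ := τ) hm1 hm3 hA hAC hCB hp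
    (by rw [hv]; positivity) (by rw [hτ]; positivity) (by rw [hv]; linarith)
    (by rw [hτ]; linarith [h.V1]) (by linarith [h.V2, sq_nonneg y, sq_nonneg g])
    (h.volume_le hm hm2)
  have cs := h.cauchy_schwarz hp hX
  have hEF := h.four_mul_E_mul_F
  have hDX := h.D_mul_X_mul_p
  have hQ := h.D_mul_excess
  have hXe := h.X_mul_p_mul_abs_le hm
  rw [abs_of_nonneg (show 0 ≤ B - C by linarith),
    abs_of_nonneg (mul_nonneg_of_nonpos_of_nonpos (sub_nonpos.2 (hAC.trans hCB))
      (sub_nonpos.2 hAC))] at cs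
  have hXe' := mul_le_mul_of_nonneg_left hXe (show 0 ≤ 2 * (B - C) by linarith)
  have hpcs := mul_le_mul_of_nonneg_left cs hp.le
  rw [← hv] at hc hEF
  have hV : 2 * (A * p * (Y * Z - W * G)) = v + τ := by rw [hτ]; linarith
  set V := A * p * (Y * Z - W * G)
  have hsq : 0 ≤ p * ((E + F - D) - (B + C) * X) ^ 2 := by positivity
  have hXT : X * p * (E + F) = (p ^ 2 + V) + X * p * (E + F - D) := by rw [← hDX]; ring
  clear_value V
  obtain rfl : V = (v + τ) / 2 := by linarith
  have hEFp : 4 * p * (E * F) = p * (2 * (m + p ^ 2 + (v + τ) / 2) + (E + F - D) ^ 2 + m + v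
      + (B - C) ^ 2 * X ^ 2) := by linear_combination p * hEF
  have hXT2 : 2 * (B + C) * (X * p * (E + F)) = 2 * (B + C) * ((p ^ 2 + (v + τ) / 2)
      + X * p * (E + F - D)) := by rw [hXT]
  linarith

theorem false_of_smallest (h : EinsteinSystem m A B C D E F X Y Z W G p y w z g)
    (hm : 0 < m) (hm2 : m ^ 2 = 4 / 3) (hAB : A ≤ B) (hAC : A ≤ C) : False := by
  have main : ∀ {A B C D E F X Y Z W G p y w z g : ℝ},
      EinsteinSystem m A B C D E F X Y Z W G p y w z g → 0 < p → 0 < X → A ≤ B → A ≤ C → False := by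
    intro A B C D E F X Y Z W G p y w z g h hp hX hAB hAC
    rcases le_total C B with h1 | h1
    · exact h.false_of_ordered hm hm2 hp hX hAC h1
    · exact h.swap.false_of_ordered hm hm2 hp hX hAB h1
  rcases pos_and_pos_or_neg_and_neg_of_mul_pos (h.p_mul_X_pos hm hm2) with ⟨hp, hX⟩ | ⟨hp, hX⟩
  · exact main h hp hX hAB hAC
  · exact main h.neg (by linarith) (by linarith) hAB hAC

/-- Diagonal solutions: all three base factors play the same role. -/
theorem false_of_diagonal (h : EinsteinSystem m A B C D E F X Y Z 0 0 p y w z g)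
    (hm : 0 < m) (hm2 : m ^ 2 = 4 / 3) : False := by
  rcases le_total A B with h1 | h1 <;> rcases le_total B C with h2 | h2 <;>
    rcases le_total A C with h3 | h3
  all_goals first
    | exact h.false_of_smallest hm hm2 (by linarith) (by linarith)
    | exact h.diag_swap_AB.false_of_smallest hm hm2 (by linarith) (by linarith)
    | exact h.diag_swap_AC.false_of_smallest hm hm2 (by linarith) (by linarith)

end EinsteinSystem

theorem exists_coupling {a b θ u v : ℝ} (ha : 0 < a) (h1 : a * u = θ * v)
    (h2 : b * v = θ * u) :
    ∃ i : ℝ, 0 ≤ i ∧ v ^ 2 = i * a ∧ u ^ 2 = i * b ∧ u * v = i * θ := by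
  by_cases hne : u ≠ 0 ∨ v ≠ 0
  · have h := mul_eq_sq_of_coupled h1 h2 hne
    have ha' := ha.ne'
    refine ⟨v ^ 2 / a, by positivity, by field_simp, ?_, ?_⟩
    · rw [div_mul_eq_mul_div, eq_div_iff ha']
      apply mul_left_cancel₀ ha'
      linear_combination (a * u + θ * v) * h1 - v ^ 2 * h
    · rw [div_mul_eq_mul_div, eq_div_iff ha']
      linear_combination v * h1
  · push Not at hne
    exact ⟨0, le_rfl, by simp [hne.2], by simp [hne.1], by simp [hne.1]⟩

namespace EinsteinSystem

variable {m A B C D E F X Y Z W G p y w z g : ℝ}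

theorem exists_couplings (h : EinsteinSystem m A B C D E F X Y Z W G p y w z g) :
    ∃ i j : ℝ, 0 ≤ i ∧ 0 ≤ j ∧
      Z ^ 2 = i * (E ^ 2 + C ^ 2 * X ^ 2 + (A - C) ^ 2) ∧
      Y ^ 2 = i * (F ^ 2 + B ^ 2 * X ^ 2 + (A - B) ^ 2) ∧
      Y * Z = i * (A * p + X * (B * E + C * F)) ∧
      G ^ 2 = j * (E ^ 2 + B ^ 2 * X ^ 2 + (A - B) ^ 2) ∧
      W ^ 2 = j * (F ^ 2 + C ^ 2 * X ^ 2 + (A - C) ^ 2) ∧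
      W * G = -(j * (A * p + X * (C * E + B * F))) := by
  have hE := h.hE
  have hF := h.hF
  obtain ⟨i, hi, i1, i2, i3⟩ := exists_coupling (by positivity) h.block_Y h.block_Z
  obtain ⟨j, hj, j1, j2, j3⟩ := exists_coupling (by positivity) h.block_W h.block_G
  exact ⟨i, j, hi, hj, i1, i2, i3, by linarith, j2, by linarith⟩

theorem horizontal_difference (h : EinsteinSystem m A B C D E F X Y Z W G p y w z g) {i j : ℝ}
    (hZ : Z ^ 2 = i * (E ^ 2 + C ^ 2 * X ^ 2 + (A - C) ^ 2))
    (hY : Y ^ 2 = i * (F ^ 2 + B ^ 2 * X ^ 2 + (A - B) ^ 2))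
    (hYZ : Y * Z = i * (A * p + X * (B * E + C * F)))
    (hG : G ^ 2 = j * (E ^ 2 + B ^ 2 * X ^ 2 + (A - B) ^ 2))
    (hW : W ^ 2 = j * (F ^ 2 + C ^ 2 * X ^ 2 + (A - C) ^ 2))
    (hWG : W * G = -(j * (A * p + X * (C * E + B * F)))) :
    (E - F) * (2 * (E + F - D) + ((E + F) * ((A - B) ^ 2 + (A - C) ^ 2)
        - X * (A * p) * (B + C)) * (i + j)) =
      (B - C) * (i - j) * (X * (A * p) * (E + F) - (E ^ 2 + F ^ 2) * (B + C - 2 * A)) := by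
  have e := h.H2.symm.trans h.H3
  rw [h.hy, h.hw, h.hz, h.hg] at e
  linear_combination e - (E ^ 2 - C ^ 2 * X ^ 2 - (A - C) ^ 2) * hY
    - (B ^ 2 * X ^ 2 - F ^ 2 + (A - B) ^ 2) * hZ - 2 * X * (C * F - B * E) * hYZ
    - (E ^ 2 - B ^ 2 * X ^ 2 - (A - B) ^ 2) * hW
    - (C ^ 2 * X ^ 2 - F ^ 2 + (A - C) ^ 2) * hG - 2 * X * (C * E - B * F) * hWG

theorem vertical_difference (h : EinsteinSystem m A B C D E F X Y Z W G p y w z g) {i j : ℝ}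
    (hZ : Z ^ 2 = i * (E ^ 2 + C ^ 2 * X ^ 2 + (A - C) ^ 2))
    (hY : Y ^ 2 = i * (F ^ 2 + B ^ 2 * X ^ 2 + (A - B) ^ 2))
    (hYZ : Y * Z = i * (A * p + X * (B * E + C * F)))
    (hG : G ^ 2 = j * (E ^ 2 + B ^ 2 * X ^ 2 + (A - B) ^ 2))
    (hW : W ^ 2 = j * (F ^ 2 + C ^ 2 * X ^ 2 + (A - C) ^ 2))
    (hWG : W * G = -(j * (A * p + X * (C * E + B * F)))) :
    (B - C) * (2 * (B + C - A + (B + C) * X ^ 2) + ((E ^ 2 + F ^ 2) * (B + C - A)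
        + 2 * (A * X ^ 2 * (A * (B + C) - B * C) + A * (A - C) * (B - A))
        - X * (A * p) * (E + F)) * (i + j)) =
      (E - F) * (i - j) * (X * (A * p) * (B + C) - (E + F) * (B ^ 2 + C ^ 2 - A * (B + C))) := by
  have e := h.V2.symm.trans h.V3
  rw [h.hy, h.hw, h.hz, h.hg] at e
  linear_combination e - (E ^ 2 - C ^ 2 * X ^ 2 + (A ^ 2 - C ^ 2)) * hY
    - (B ^ 2 * X ^ 2 - F ^ 2 - (A ^ 2 - B ^ 2)) * hZ - 2 * X * (C * F - B * E) * hYZ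
    - (B ^ 2 * X ^ 2 - E ^ 2 - (A ^ 2 - B ^ 2)) * hW
    - (F ^ 2 - C ^ 2 * X ^ 2 + (A ^ 2 - C ^ 2)) * hG - 2 * X * (B * F - C * E) * hWG

theorem E_eq_F_of_B_eq_C (h : EinsteinSystem m A B B D E F X Y Z W G p y w z g) (hm : 0 < m)
    (hp : 0 < p) : E = F := by
  obtain ⟨i, j, hi, hj, hZ, hY, hYZ, hG, hW, hWG⟩ := h.exists_couplings
  have e := h.horizontal_difference hZ hY hYZ hG hW hWG
  by_contra hne
  have e1 : 2 * (E + F - D) + ((E + F) * ((A - B) ^ 2 + (A - B) ^ 2)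
      - X * (A * p) * (B + B)) * (i + j) = 0 := by
    apply mul_left_cancel₀ (sub_ne_zero.2 hne)
    linear_combination e
  have hA := h.hA
  have hB := h.hB
  have hE := h.hE
  have hF := h.hF
  have hV : A * p * (Y * Z - W * G) = A * p * ((i + j) * (A * p + B * X * (E + F))) := by
    rw [hYZ, hWG]; ring
  have hx := h.excess_pos hm
  have hQ := h.D_mul_excess
  have h1 : 0 ≤ (E + F) * (A - B) ^ 2 * (i + j) := by positivity
  have h2 : E + F - D ≤ X * (A * p) * B * (i + j) := by linarith
  have h3 := mul_le_mul_of_nonneg_left h2 (show 0 ≤ E + F by positivity)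
  have h4 : 0 ≤ A * p * ((i + j) * (A * p)) := by positivity
  have h5 : 0 < (E + F - D) * (E + F - D) := mul_pos hx hx
  linarith [sq_nonneg p]

/-- When the last two base parameters agree, a solution can be rotated to a diagonal one. -/
theorem false_of_B_eq_C (h : EinsteinSystem m A B B D E F X Y Z W G p y w z g)
    (hm : 0 < m) (hm2 : m ^ 2 = 4 / 3) (hp : 0 < p) (hX : 0 < X) : False := by
  obtain rfl := h.E_eq_F_of_B_eq_C hm hp
  have hA := h.hA
  have hB := h.hB
  have hE := h.hE
  have hk : E ^ 2 + B ^ 2 * X ^ 2 + (A - B) ^ 2 = A * p + X * (B * E + B * E) := by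
    have : (E ^ 2 + B ^ 2 * X ^ 2 + (A - B) ^ 2) * (E ^ 2 + B ^ 2 * X ^ 2 + (A - B) ^ 2) =
        (A * p + X * (B * E + B * E)) ^ 2 := by
      rcases h.block_ne_zero (mul_pos hp hX) with hne | hne
      · exact mul_eq_sq_of_coupled h.block_Y h.block_Z hne
      · exact mul_eq_sq_of_coupled h.block_W h.block_G hne
    rw [← sq] at this
    exact (sq_eq_sq₀ (by positivity) (by positivity)).1 this
  have hk0 : A * p + X * (B * E + B * E) ≠ 0 := by positivity
  obtain rfl : Y = Z := by
    apply mul_left_cancel₀ hk0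
    rw [← h.block_Y, hk]
  obtain rfl : G = -W := by
    apply mul_left_cancel₀ hk0
    linear_combination -h.block_G - G * hk
  obtain ⟨r, hr⟩ : ∃ r : ℝ, r ^ 2 = Y ^ 2 + W ^ 2 := ⟨_, Real.sq_sqrt (by positivity)⟩
  obtain ⟨-, -, -, hD, -, -, vol, hp', hy, hw, hz, hg, H1, H2, H3, V1, V2, V3, -, -, -, -, OX⟩ := h
  subst hy hw hz hg
  have : EinsteinSystem m A B B D E E X r r 0 0 p ((E - B * X) * r) 0 ((E - B * X) * r) 0 := by
    constructor <;> try first | assumption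
    · linear_combination hp' + A * hr
    · ring
    · ring
    · ring
    · ring
    · linear_combination H1 + 2 * (E - B * X) ^ 2 * hr
    · linear_combination H2 + ((E - B * X) ^ 2 + (A - B) ^ 2) * hr
    · linear_combination H3 + ((E - B * X) ^ 2 + (A - B) ^ 2) * hr
    · linear_combination V1 - 2 * (A ^ 2 - B ^ 2) * hr
    · linear_combination V2 - ((E - B * X) ^ 2 - (A ^ 2 - B ^ 2)) * hr
    · linear_combination V3 - ((E - B * X) ^ 2 - (A ^ 2 - B ^ 2)) * hr
    · linear_combination r * hk
    · linear_combination r * hk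
    · ring
    · ring
    · linear_combination OX - 2 * B * (E - B * X) * hr
  exact this.false_of_diagonal hm hm2

end EinsteinSystem

namespace EinsteinSystem

variable {m A B C D E F X Y Z W G p y w z g : ℝ}

theorem coupling_le_of_middle (h : EinsteinSystem m A B C D E F X Y Z W G p y w z g)
    (hCA : C ≤ A) (hAB : A ≤ B) : A * p * (Y * Z - W * G) ≤ 3 * m - p ^ 2 := by
  have hA := h.hA
  have hC := h.hC
  have h1 : 0 ≤ 2 * A * (B - A) * (W ^ 2 + Z ^ 2) :=
    mul_nonneg (mul_nonneg (by linarith) (by linarith)) (by positivity)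
  have h2 : 0 ≤ 2 * C * (A - C) * (Y ^ 2 + G ^ 2) :=
    mul_nonneg (mul_nonneg (by linarith) (by linarith)) (by positivity)
  have h3 : 0 ≤ (B - C) * ((B + C) * X ^ 2) :=
    mul_nonneg (by linarith) (mul_nonneg (by linarith) (by positivity))
  have h4 : 0 ≤ A * (B - A) := mul_nonneg hA.le (by linarith)
  have h5 : 0 ≤ C * (B - C) := mul_nonneg hC.le (by linarith)
  have h6 : 0 < A * C := mul_pos hA hC
  linarith [h.coupling_mul, h.sum_vertical, h.V1, h.V2, sq_nonneg y, sq_nonneg g]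

theorem E_mul_F_le_of_block_YZ (h : EinsteinSystem m A B C D E F X Y Z W G p y w z g)
    (hp : 0 < p) (hX : 0 < X) (hne : Y ≠ 0 ∨ Z ≠ 0) :
    E * F ≤ A * p + X * (B * E + C * F) := by
  have hA := h.hA
  have hB := h.hB
  have hC := h.hC
  have hE := h.hE
  have hF := h.hF
  refine le_of_coupled (by positivity) h.block_Y h.block_Z ?_ hne
  rw [mul_pow]
  exact mul_le_mul (by nlinarith [sq_nonneg (C * X), sq_nonneg (A - C)])
    (by nlinarith [sq_nonneg (B * X), sq_nonneg (A - B)]) (by positivity) (by positivity)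

theorem E_mul_F_le_of_block_WG (h : EinsteinSystem m A B C D E F X Y Z W G p y w z g)
    (hp : 0 < p) (hX : 0 < X) (hne : W ≠ 0 ∨ -G ≠ 0) :
    E * F ≤ A * p + X * (C * E + B * F) := by
  have hA := h.hA
  have hB := h.hB
  have hC := h.hC
  have hE := h.hE
  have hF := h.hF
  refine le_of_coupled (by positivity) h.block_W h.block_G ?_ hne
  rw [mul_pow]
  exact mul_le_mul (by nlinarith [sq_nonneg (B * X), sq_nonneg (A - B)])
    (by nlinarith [sq_nonneg (C * X), sq_nonneg (A - C)]) (by positivity) (by positivity)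

/-- Compatibility of the two nonzero coupling blocks. -/
theorem compatibility (h : EinsteinSystem m A B C D E F X Y Z W G p y w z g)
    (hYZ : Y ≠ 0 ∨ Z ≠ 0) (hWG : W ≠ 0 ∨ -G ≠ 0) (hBC : B ≠ C) (hEF : E ≠ F) :
    2 * (A * p * X) = (E + F) * (B + C - 2 * A) := by
  have h1 := mul_eq_sq_of_coupled h.block_Y h.block_Z hYZ
  have h2 := mul_eq_sq_of_coupled h.block_W h.block_G hWG
  apply mul_left_cancel₀ (mul_ne_zero (sub_ne_zero.2 hBC) (sub_ne_zero.2 hEF))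
  linear_combination h2 - h1

end EinsteinSystem

/-- Numerical contradiction behind the case of two incompatible coupling blocks;
`x` is the excess `E + F - D`. -/
theorem false_of_excess_bounds {m P V Q S x D e ε T : ℝ} (hm : 0 < m) (hP : 0 ≤ P) (hV : 0 ≤ V)
    (hQ : Q = m + P + V) (hVm : V ≤ 3 * m) (hx : 0 < x) (hDx : D * x = Q) (hT : T = x + D)
    (hε : 4 * ε = 2 * Q + x ^ 2 + S) (he : 4 * ε = T ^ 2 - e ^ 2) (hex : |e| * x ≤ V)
    (hS : 0 < S) (hmain : 8 * ε ^ 2 * x ≤ T * V ^ 2) : False := by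
  have hQ0 : 0 < Q := by rw [hQ]; positivity
  have hK : (m + P) * (m + P + 2 * V) ≤ x ^ 2 * S := by
    have h1 : (e * x) ^ 2 ≤ V ^ 2 := by
      rw [mul_pow, ← sq_abs e, ← mul_pow]
      exact pow_le_pow_left₀ (by positivity) hex 2
    have h2 : x * T = x ^ 2 + Q := by rw [hT, ← hDx]; ring
    have h3 : x ^ 2 * (2 * Q + x ^ 2 + S) = (x ^ 2 + Q) ^ 2 - (e * x) ^ 2 := by
      rw [← hε, he, ← h2]; ring
    have h4 : Q ^ 2 - V ^ 2 = (m + P) * (m + P + 2 * V) := by rw [hQ]; ring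
    linarith
  have h5 : 8 * ε ^ 2 * x ^ 2 ≤ (x ^ 2 + Q) * V ^ 2 := by
    have := mul_le_mul_of_nonneg_right hmain hx.le
    have h2 : x * T = x ^ 2 + Q := by rw [hT, ← hDx]; ring
    calc 8 * ε ^ 2 * x ^ 2 = 8 * ε ^ 2 * x * x := by ring
      _ ≤ T * V ^ 2 * x := this
      _ = (x * T) * V ^ 2 := by ring
      _ = _ := by rw [h2]
  have hVQ : V ^ 2 ≤ Q ^ 2 := pow_le_pow_left₀ hV (by rw [hQ]; linarith) 2
  have h6 : Q ^ 2 + 2 * Q * S + S ^ 2 / 2 ≤ 8 * ε ^ 2 - V ^ 2 := by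
    have : 8 * ε ^ 2 = (2 * Q + x ^ 2 + S) ^ 2 / 2 := by rw [← hε]; ring
    have h7 : (2 * Q + S) ^ 2 ≤ (2 * Q + x ^ 2 + S) ^ 2 :=
      pow_le_pow_left₀ (by positivity) (by linarith [sq_nonneg x]) 2
    linarith
  have h8 : 3 * Q * S ≤ 8 * ε ^ 2 - V ^ 2 := by nlinarith [sq_nonneg (Q - S / 2), sq_nonneg S]
  have h9 : x ^ 2 * (3 * Q * S) ≤ Q * V ^ 2 := by
    have := mul_le_mul_of_nonneg_left h8 (sq_nonneg x)
    linarith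
  have h10 : 3 * (x ^ 2 * S) ≤ V ^ 2 := by
    refine le_of_mul_le_mul_left ?_ hQ0
    linarith
  have h11 : V * V ≤ V * (3 * m) := mul_le_mul_of_nonneg_left hVm hV
  have h12 : 0 < m * m := mul_pos hm hm
  have h13 : 0 ≤ m * V := by positivity
  have h14 : 0 ≤ m * P := by positivity
  have h15 : 0 ≤ P * V := by positivity
  nlinarith [sq_nonneg P]

theorem vertical_estimate {A B C d e s T σ X P M : ℝ} (hd : d = B - C) (hs : s = B + C)
    (hσ : σ = B + C - 2 * A) (hA : 0 < A) (hC : 0 < C) (hCA : C ≤ A) (hT : 0 < T)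
    (hσ0 : 0 < σ) (hM : |M| ≤ P)
    (h : 2 * (s - A + s * X ^ 2) + ((T ^ 2 + e ^ 2) / 2 * (s - A)
      + 2 * (A * X ^ 2 * (A * s - B * C) + A * (A - C) * (B - A)) - T ^ 2 * σ / 2) * P
      = -(1 / 2) * (e * T * d * M)) :
    8 * (s * X ^ 2) ≤ T ^ 2 * σ * P := by
  have hP : 0 ≤ P := (abs_nonneg M).trans hM
  have hd0 : 0 ≤ d := by linarith
  have h1 : -(e * T * d * M) ≤ |e| * T * d * P := by
    calc -(e * T * d * M) ≤ |e * T * d * M| := neg_le_abs _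
      _ = |e| * T * d * |M| := by rw [abs_mul, abs_mul, abs_mul, abs_of_pos hT, abs_of_nonneg hd0]
      _ ≤ _ := mul_le_mul_of_nonneg_left hM (by positivity)
  have h2 : 2 * (|e| * T) ≤ T ^ 2 + e ^ 2 := by nlinarith [sq_nonneg (|e| - T), sq_abs e]
  have h3 : d * P * (2 * (|e| * T)) ≤ d * P * (T ^ 2 + e ^ 2) :=
    mul_le_mul_of_nonneg_left h2 (by positivity)
  have h4 : d * P * (T ^ 2 + e ^ 2) ≤ s * P * (T ^ 2 + e ^ 2) :=
    mul_le_mul_of_nonneg_right (mul_le_mul_of_nonneg_right (by linarith) hP) (by positivity)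
  have h5 : 0 ≤ A * s - B * C := by
    rw [hs]
    have : 0 ≤ B * (A - C) := mul_nonneg (by linarith) (by linarith)
    nlinarith [mul_pos hA hC]
  have h6 : 0 ≤ A * X ^ 2 * (A * s - B * C) * P := by positivity
  have h7 : 0 ≤ A * (A - C) * (B - A) * P :=
    mul_nonneg (mul_nonneg (mul_nonneg hA.le (by linarith)) (by linarith)) hP
  have h8 : (T ^ 2 + e ^ 2) * (s - A) * P = (T ^ 2 + e ^ 2) * (s + σ) / 2 * P := by
    rw [hs, hσ]; ring
  have h9 : 0 ≤ e ^ 2 * σ * P := by positivity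
  have h10 : 0 < s - A := by linarith
  linarith

theorem horizontal_estimate {A B C d e s T σ x P M : ℝ} (hd : d = B - C) (hs : s = B + C)
    (hσ : σ = B + C - 2 * A) (hCA : C ≤ A) (hσ0 : 0 < σ)
    (heT : |e| ≤ T) (hM : |M| ≤ P)
    (h : 2 * x + (T * ((A - B) ^ 2 + (A - C) ^ 2) - T * σ / 2 * s) * P
      = -(1 / 2) * (d * σ * e * M)) :
    2 * x ≤ A * σ * T * P := by
  have hP : 0 ≤ P := (abs_nonneg M).trans hM
  have hT : 0 ≤ T := (abs_nonneg e).trans heT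
  have hd0 : 0 ≤ d := by linarith
  have h1 : -(d * σ * e * M) ≤ d * σ * T * P := by
    calc -(d * σ * e * M) ≤ |d * σ * e * M| := neg_le_abs _
      _ = d * σ * (|e| * |M|) := by
        rw [abs_mul, abs_mul, abs_mul, abs_of_pos hσ0, abs_of_nonneg hd0]; ring
      _ ≤ d * σ * (T * P) := by gcongr
      _ = _ := by ring
  have h2 : d * σ * T * P ≤ d * d * T * P := by
    gcongr
    linarith
  have h3 : T * ((A - B) ^ 2 + (A - C) ^ 2) * P = T * (d ^ 2 + σ ^ 2) / 2 * P := by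
    rw [hd, hσ]; ring
  have h4 : T * σ * s * P - T * σ ^ 2 * P = 2 * (A * σ * T * P) := by rw [hs, hσ]; ring
  linarith

namespace EinsteinSystem

variable {m A B C D E F X Y Z W G p y w z g : ℝ}

theorem false_of_ne_of_middle (h : EinsteinSystem m A B C D E F X Y Z W G p y w z g)
    (hm : 0 < m) (hp : 0 < p) (hX : 0 < X) (hYZ0 : Y ≠ 0 ∨ Z ≠ 0) (hWG0 : W ≠ 0 ∨ -G ≠ 0)
    (hBC : B ≠ C) (hEF : E ≠ F) (hCA : C ≤ A) (hAB : A ≤ B) : False := by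
  have hA := h.hA
  have hB := h.hB
  have hC := h.hC
  have hD := h.hD
  have hE := h.hE
  have hF := h.hF
  have rel := h.compatibility hYZ0 hWG0 hBC hEF
  obtain ⟨i, j, hi, hj, hZ, hY, hYZ, hG, hW, hWG⟩ := h.exists_couplings
  have hθ := h.E_mul_F_le_of_block_YZ hp hX hYZ0
  have hφ := h.E_mul_F_le_of_block_WG hp hX hWG0
  have hM : |i - j| ≤ i + j := abs_le.2 ⟨by linarith, by linarith⟩
  have hσ : 0 < B + C - 2 * A := by
    have : 0 < (E + F) * (B + C - 2 * A) := by rw [← rel]; positivity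
    exact (mul_pos_iff_of_pos_left (by positivity)).1 this
  have rel' : X * (A * p) = (E + F) * (B + C - 2 * A) / 2 := by linarith
  have hV : A * p * (i + j) * (E * F) ≤ A * p * (Y * Z - W * G) := by
    rw [hYZ, hWG]
    have h1 := mul_le_mul_of_nonneg_left hθ (show 0 ≤ A * p * i by positivity)
    have h2 := mul_le_mul_of_nonneg_left hφ (show 0 ≤ A * p * j by positivity)
    linarith
  have hv : 8 * ((B + C) * X ^ 2) ≤ (E + F) ^ 2 * (B + C - 2 * A) * (i + j) := by
    refine vertical_estimate (e := E - F) (M := i - j) rfl rfl rfl hA hC hCA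
      (by positivity) hσ hM ?_
    have e := h.vertical_difference hZ hY hYZ hG hW hWG
    rw [rel'] at e
    apply mul_left_cancel₀ (sub_ne_zero.2 hBC)
    linear_combination e
  have hh : 2 * (E + F - D) ≤ A * (B + C - 2 * A) * (E + F) * (i + j) := by
    refine horizontal_estimate (B := B) (C := C) (e := E - F) (M := i - j) rfl rfl rfl hCA hσ
      (abs_le.2 ⟨by linarith, by linarith⟩) hM ?_
    have e := h.horizontal_difference hZ hY hYZ hG hW hWG
    rw [rel'] at e
    apply mul_left_cancel₀ (sub_ne_zero.2 hEF)
    linear_combination e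
  have hv' : 4 * ((B + C) * X) ≤ (E + F) * (A * p * (i + j)) := by
    refine le_of_mul_le_mul_left ?_ hX
    have : (E + F) ^ 2 * (B + C - 2 * A) * (i + j) = 2 * (X * ((E + F) * (A * p * (i + j)))) := by
      linear_combination -(E + F) * (i + j) * rel
    linarith
  have hh' : E + F - D ≤ A * X * (A * p * (i + j)) := by
    have : A * (B + C - 2 * A) * (E + F) * (i + j) = 2 * (A * X * (A * p * (i + j))) := by
      linear_combination -A * (i + j) * rel
    linarith
  have hx := h.excess_pos hm
  have hVc := h.coupling_le_of_middle hCA hAB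
  have hV0 := h.coupling_nonneg
  have hω : 0 ≤ A * p * (i + j) := by positivity
  have hmain : 8 * (E * F) ^ 2 * (E + F - D) ≤ (E + F) * (A * p * (Y * Z - W * G)) ^ 2 := by
    set V := A * p * (Y * Z - W * G)
    set ω := A * p * (i + j)
    have h1 : E + F - D ≤ (B + C) * X / 2 * ω := by
      refine hh'.trans (mul_le_mul_of_nonneg_right ?_ hω)
      have : 0 ≤ (B + C - 2 * A) * X := by positivity
      linarith
    have h2 : 8 * (E + F - D) ≤ (E + F) * ω ^ 2 := by
      have := mul_le_mul_of_nonneg_right hv' hω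
      linarith
    have h3 : (ω * (E * F)) ^ 2 ≤ V ^ 2 := pow_le_pow_left₀ (by positivity) hV 2
    calc 8 * (E * F) ^ 2 * (E + F - D) = (E * F) ^ 2 * (8 * (E + F - D)) := by ring
      _ ≤ (E * F) ^ 2 * ((E + F) * ω ^ 2) := mul_le_mul_of_nonneg_left h2 (by positivity)
      _ = (E + F) * (ω * (E * F)) ^ 2 := by ring
      _ ≤ _ := mul_le_mul_of_nonneg_left h3 (by positivity)
  refine false_of_excess_bounds (S := m + (y ^ 2 + g ^ 2 + z ^ 2 + w ^ 2) + (B - C) ^ 2 * X ^ 2)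
    (D := D) (e := E - F) hm (sq_nonneg p) hV0 rfl (by linarith [sq_nonneg p]) hx h.D_mul_excess
    rfl ?_ ?_ (h.abs_sub_mul_excess_le hm) (by positivity) (ε := E * F) ?_
  · linear_combination h.four_mul_E_mul_F
  · ring
  · convert hmain using 2
    ring

theorem E_eq_F (h : EinsteinSystem m A B C D E F X Y Z W G p y w z g)
    (hm : 0 < m) (hm2 : m ^ 2 = 4 / 3) (hp : 0 < p) (hX : 0 < X)
    (hYZ : Y ≠ 0 ∨ Z ≠ 0) (hWG : W ≠ 0 ∨ -G ≠ 0) (hBC : B ≠ C) : E = F := by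
  by_contra hEF
  have hA := h.hA
  have hE := h.hE
  have hF := h.hF
  have rel := h.compatibility hYZ hWG hBC hEF
  have hσ : 0 < B + C - 2 * A := by
    have : 0 < (E + F) * (B + C - 2 * A) := by rw [← rel]; positivity
    exact (mul_pos_iff_of_pos_left (by positivity)).1 this
  rcases le_total A B with h1 | h1 <;> rcases le_total A C with h2 | h2
  · exact h.false_of_smallest hm hm2 h1 h2
  · exact h.false_of_ne_of_middle hm hp hX hYZ hWG hBC hEF h2 h1
  · exact h.swap.false_of_ne_of_middle hm hp hX (by simpa using hWG) (by simpa using hYZ)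
      hBC.symm hEF h1 h2
  · linarith

end EinsteinSystem

theorem excess_product_le {m P V Q E L θ a ν : ℝ} (hθ : θ = a + E * L)
    (hQE : Q ≤ E ^ 2) (hEθ : E ^ 2 ≤ θ) (hQ : Q = m + P + V) (hQ0 : 0 < Q) (ha : 0 ≤ a)
    (hV0 : 0 ≤ V) (ham : a ≤ m + P) (hV : V = ν * θ) :
    (Q - a) * (m + P - a) ≤ Q * (L ^ 2 - E * L * ν) := by
  have hθ0 : 0 < θ := by linarith
  have h1 : (m + P - a) * (E * L) ≤ θ * (L ^ 2 - E * L * ν) := by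
    have h2 : 0 ≤ (θ - E ^ 2) * L ^ 2 := mul_nonneg (by linarith) (sq_nonneg L)
    have h3 : 0 ≤ E * L := by linarith
    have h4 : 0 ≤ E * L * (E * L - V - (m + P - a)) := mul_nonneg h3 (by linarith)
    have h5 : E * L * V = E * L * (ν * θ) := by rw [hV]
    linarith
  refine le_of_mul_le_mul_left ?_ hθ0
  have h6 : 0 ≤ a * (θ - Q) * (m + P - a) :=
    mul_nonneg (mul_nonneg ha (by linarith)) (by linarith)
  have h7 := mul_le_mul_of_nonneg_left h1 hQ0.le
  have h8 : E * L = θ - a := by linarith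
  rw [h8] at h7 ⊢
  linarith

namespace EinsteinSystem

variable {m A B C D E F X Y Z W G p y w z g : ℝ}

theorem exists_coupling_of_E_eq_F (h : EinsteinSystem m A B C D E E X Y Z W G p y w z g)
    (hp : 0 < p) (hX : 0 < X) (hBC : B ≠ C) :
    ∃ ω : ℝ, 0 ≤ ω ∧
      A * p * (Y * Z - W * G) = A * p * ω * (A * p + E * ((B + C) * X)) ∧
      E ^ 2 ≤ A * p + E * ((B + C) * X) ∧
      W ^ 2 + Z ^ 2 = ω * (E ^ 2 + C ^ 2 * X ^ 2 + (A - C) ^ 2) ∧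
      Y ^ 2 + G ^ 2 = ω * (E ^ 2 + B ^ 2 * X ^ 2 + (A - B) ^ 2) ∧
      (B + C) * (B + C - A) + ((B + C) * X) ^ 2 + (B + C) * (ω * (E ^ 2 * (B + C - A)
        + A * X ^ 2 * (A * (B + C) - B * C) + A * (A - C) * (B - A)))
        = E * ((B + C) * X) * (A * p * ω) := by
  obtain ⟨i, j, hi, hj, hZ, hY, hYZ, hG, hW, hWG⟩ := h.exists_couplings
  refine ⟨i + j, by positivity, ?_, ?_, ?_, ?_, ?_⟩
  · rw [hYZ, hWG]; ring
  · rcases h.block_ne_zero (mul_pos hp hX) with hne | hne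
    · linarith [h.E_mul_F_le_of_block_YZ hp hX hne]
    · linarith [h.E_mul_F_le_of_block_WG hp hX hne]
  · linear_combination hW + hZ
  · linear_combination hY + hG
  · apply mul_left_cancel₀ (sub_ne_zero.2 hBC)
    linear_combination (B + C) / 2 * h.vertical_difference hZ hY hYZ hG hW hWG

end EinsteinSystem

theorem false_of_middle_bounds {m A E D X p V L : ℝ} (hm : 0 < m) (hp : 0 < p)
    (hX : 0 < X) (hE : 0 < E) (hA : 0 < A) (hV0 : 0 ≤ V)
    (hDX : D * X * p = p ^ 2 + V) (hQ : D * (E + E - D) = m + p ^ 2 + V)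
    (hVm : V ≤ 3 * m - p ^ 2) (hθ : E ^ 2 ≤ A * p + E * L) (hL : A * X ≤ L) (hLV : E * L < V) :
    False := by
  have hQE : m + p ^ 2 + V ≤ E ^ 2 := by nlinarith [sq_nonneg (E - D)]
  have hAp : m + p ^ 2 < A * p := by linarith
  have hD2 : D < 2 * E := by
    have : 0 < D * (E + E - D) := by rw [hQ]; positivity
    by_contra! hc
    have hD : 0 < D := by linarith
    nlinarith
  have h1 : A * (p ^ 2 + V) ≤ 2 * p * (E * L) := by
    rw [← hDX]
    have h2 : D * (A * X * p) ≤ 2 * E * (A * X * p) :=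
      mul_le_mul_of_nonneg_right hD2.le (by positivity)
    have h3 : 2 * E * p * (A * X) ≤ 2 * E * p * L := mul_le_mul_of_nonneg_left hL (by positivity)
    linarith
  have h2 : A * (p ^ 2 + V) < 2 * p * V := by
    have := mul_lt_mul_of_pos_left hLV (show 0 < 2 * p by positivity)
    linarith
  obtain ⟨q, hq0, rfl⟩ : ∃ q : ℝ, 0 < q ∧ m = q ^ 2 :=
    ⟨Real.sqrt m, Real.sqrt_pos.2 hm, (Real.sq_sqrt hm.le).symm⟩
  have hA2 : 2 * q < A := by
    refine lt_of_mul_lt_mul_right ?_ hp.le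
    nlinarith [sq_nonneg (p - q)]
  have h3 : A < 2 * p := by
    by_contra! hc
    nlinarith [mul_pos hA (pow_pos hp 2), mul_nonneg (sub_nonneg.2 hc) hV0]
  have h4 : A * p ^ 2 < (2 * p - A) * (3 * q ^ 2 - p ^ 2) := by
    have := mul_le_mul_of_nonneg_left hVm (show 0 ≤ 2 * p - A by linarith)
    linarith
  have h5 : 0 < q ^ 2 * (A - 2 * q) := mul_pos (by positivity) (by linarith)
  have h6 : 0 ≤ (p - q) ^ 2 * (p + 2 * q) := by positivity
  have h7 : 0 < q ^ 3 := by positivity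
  nlinarith

namespace EinsteinSystem

variable {m A B C D E F X Y Z W G p y w z g : ℝ}

theorem false_of_middle (h : EinsteinSystem m A B C D E E X Y Z W G p y w z g)
    (hm : 0 < m) (hp : 0 < p) (hX : 0 < X) (hBC : B ≠ C) (hCA : C ≤ A) (hAB : A ≤ B) : False := by
  have hA := h.hA
  have hB := h.hB
  have hC := h.hC
  have hE := h.hE
  obtain ⟨ω, hω, hV, hθ, -, -, hf⟩ := h.exists_coupling_of_E_eq_F hp hX hBC
  have hL0 : 0 < (B + C) * X := by positivity
  have hL : A * X ≤ (B + C) * X := mul_le_mul_of_nonneg_right (by linarith) hX.le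
  refine false_of_middle_bounds (D := D) hm hp hX hE hA h.coupling_nonneg h.D_mul_X_mul_p
    h.D_mul_excess (h.coupling_le_of_middle hCA hAB) hθ hL ?_
  set L := (B + C) * X
  have h1 : 0 ≤ (B + C) * (ω * (E ^ 2 * (B + C - A)
        + A * X ^ 2 * (A * (B + C) - B * C) + A * (A - C) * (B - A))) := by
    have h2 : 0 ≤ A * (B + C) - B * C := by
      nlinarith [mul_pos hA hC, mul_nonneg hB.le (sub_nonneg.2 hCA)]
    have h3 : 0 ≤ B + C - A := by linarith
    have h4 : 0 ≤ A - C := by linarith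
    have h5 : 0 ≤ B - A := by linarith
    positivity
  have h2 : 0 < (B + C) * (B + C - A) := mul_pos (by positivity) (by linarith)
  have h3 : L < E * (A * p * ω) := by
    refine lt_of_mul_lt_mul_left ?_ hL0.le
    linarith
  rw [hV]
  calc E * L < E * (E * (A * p * ω)) := mul_lt_mul_of_pos_left h3 hE
    _ = A * p * ω * E ^ 2 := by ring
    _ ≤ _ := mul_le_mul_of_nonneg_left hθ (by positivity)

end EinsteinSystem

/-- The largest base parameter exceeds the sum of the other two. -/
theorem false_of_largest_bounds_of_lt {m A s E L P Q V n p ω θ : ℝ} (hm1 : 1.1547 < m)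
    (hm3 : m < 1.15471) (hA : 0 < A) (hs : 0 < s) (hsA : s < A) (hp : 0 < p) (hE : 0 < E)
    (hL : 0 < L) (hP : P = p ^ 2) (hθ : θ = A * p + E * L) (hEθ : E ^ 2 ≤ θ)
    (hQE : Q ≤ E ^ 2) (hQ : Q = m + P + V) (hV : V = A * p * ω * θ) (hVn : 2 * m + n ≤ 2 * V)
    (hn0 : 0 ≤ n) (hn : n ≤ m - P - (A ^ 2 - s ^ 2))
    (hnω : ω * A ^ 2 * (E ^ 2 + 3 / 8 * L ^ 2) ≤ n)
    (hmain : A * (L ^ 2 - E * L * (A * p * ω)) ≤ A * (s * (A - s)) + 2 / 3 * (s * n)) :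
    False := by
  have hP0 : 0 ≤ P := by rw [hP]; positivity
  have hθ0 : 0 < θ := by rw [hθ]; positivity
  have hAs : 0 < A ^ 2 - s ^ 2 := by nlinarith
  have hnm : n ≤ m - P := by linarith
  have hQ2 : 2 * m + P ≤ Q := by linarith
  have hR : 0 < E ^ 2 + 3 / 8 * L ^ 2 := by positivity
  -- an upper bound for `A * p`
  have h1 : A * V * (E ^ 2 + 3 / 8 * L ^ 2) ≤ n * p * θ := by
    have := mul_le_mul_of_nonneg_right hnω (show 0 ≤ p * θ by positivity)
    rw [hV]
    linarith
  have h2 : n * p * (E * L) ≤ n * p * (0.82 * (E ^ 2 + 3 / 8 * L ^ 2)) := by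
    refine mul_le_mul_of_nonneg_left ?_ (by positivity)
    nlinarith [sq_nonneg (E - 0.61 * L), sq_nonneg E]
  have h3 : n * P * A * 3 ≤ n * A * (E ^ 2 + 3 / 8 * L ^ 2) := by
    have : 3 * P ≤ E ^ 2 + 3 / 8 * L ^ 2 := by
      nlinarith [sq_nonneg L]
    have := mul_le_mul_of_nonneg_left this (show 0 ≤ n * A by positivity)
    linarith
  have h4 : A * V ≤ 0.82 * (n * p) + n * A / 3 := by
    refine le_of_mul_le_mul_right ?_ hR
    have : n * p * θ = n * P * A + n * p * (E * L) := by rw [hθ, hP]; ring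
    linarith
  have h5 : A * m ≤ 0.82 * (n * p) := by
    have h6 := mul_le_mul_of_nonneg_left hVn hA.le
    have h7 : 0 ≤ A * n := by positivity
    linarith
  have h8 : A * p ≤ 0.24 := by
    have h9 : A * p * m ≤ 0.82 * (n * P) := by
      have := mul_le_mul_of_nonneg_right h5 hp.le
      rw [hP]; linarith
    have h10 : n * P ≤ (m - P) * P := mul_le_mul_of_nonneg_right hnm hP0
    nlinarith [sq_nonneg (m - 2 * P)]
  -- the remaining term
  have h11 : A * (L ^ 2 - E * L * (A * p * ω)) ≤ A * (2 / 3 * (m - P)) := by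
    refine hmain.trans ?_
    have h12 := mul_le_mul_of_nonneg_left hn hs.le
    have h13 : 0 ≤ (A - s) * (2 * (m - P) - s * (A - 2 * s)) := by
      refine mul_nonneg (by linarith) ?_
      linarith [mul_pos hA (sub_pos.2 hsA), sq_nonneg A]
    linarith
  have h12 := le_of_mul_le_mul_left h11 hA
  have h13 := excess_product_le (m := m) (P := P) hθ hQE hEθ hQ (by linarith)
    (by positivity) (by linarith) (by linarith) hV
  have h14 := mul_le_mul_of_nonneg_left h12 (show 0 ≤ Q by linarith)
  have h15 : 0.89 * Q ≤ Q - A * p := by linarith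
  have h16 : 0.89 * Q * (m + P - A * p) ≤ (Q - A * p) * (m + P - A * p) :=
    mul_le_mul_of_nonneg_right h15 (by linarith)
  have h17 : 0.89 * (m + P - A * p) ≤ 2 / 3 * (m - P) := by
    refine le_of_mul_le_mul_left ?_ (show 0 < Q by linarith)
    linarith
  linarith

/-- The largest base parameter is at most the sum of the other two. -/
theorem false_of_largest_bounds_of_le {m A ξ E L P Q V n p ω θ : ℝ} (hm1 : 1.1547 < m)
    (hm3 : m < 1.15471) (hA : 0 < A) (hp : 0 < p) (hE : 0 < E)
    (hL : 0 < L) (hP : P = p ^ 2) (hθ : θ = A * p + E * L) (hEθ : E ^ 2 ≤ θ)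
    (hQE : Q ≤ E ^ 2) (hQ : Q = m + P + V) (hV : V = A * p * ω * θ) (hVP : 2.366 - P ≤ 2 * V)
    (hξ : 0 ≤ ξ) (hn0 : 0 ≤ n) (hn : n ≤ m - P - ξ)
    (hnω : 1.2 < A → 0.87 * (ω * A ^ 2 * (E ^ 2 + L ^ 2 / 4)) ≤ n)
    (hmain : E ^ 2 * (L ^ 2 - E * L * (A * p * ω)) ≤ n * ξ) : False := by
  have hP0 : 0 ≤ P := by rw [hP]; positivity
  have hθ0 : 0 < θ := by rw [hθ]; positivity
  have hnm : n ≤ m - P := by linarith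
  have hQ2 : 2.337 + P / 2 ≤ Q := by linarith
  have hA2 : A ≤ 1.2 := by
    by_contra! hc
    have hR : 0 < E ^ 2 + L ^ 2 / 4 := by positivity
    have h1 : 0.87 * (A * V * (E ^ 2 + L ^ 2 / 4)) ≤ n * p * θ := by
      have := mul_le_mul_of_nonneg_right (hnω hc) (show 0 ≤ p * θ by positivity)
      rw [hV]
      linarith
    have h2 : n * p * (E * L) ≤ n * p * (E ^ 2 + L ^ 2 / 4) := by
      refine mul_le_mul_of_nonneg_left ?_ (by positivity)
      linarith [sq_nonneg (E - L / 2)]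
    have h3 : n * P * A * 2.337 ≤ n * P * A * (E ^ 2 + L ^ 2 / 4) := by
      refine mul_le_mul_of_nonneg_left ?_ (by positivity)
      linarith [sq_nonneg L]
    have h4 : 0.87 * (A * V) ≤ n * p + n * P * A * 0.43 := by
      refine le_of_mul_le_mul_right ?_ hR
      have : n * p * θ = n * P * A + n * p * (E * L) := by rw [hθ, hP]; ring
      have : 0 ≤ n * P * A := by positivity
      linarith
    have h5 : n * P ≤ (m - P) * P := mul_le_mul_of_nonneg_right hnm hP0
    have h6 : n * p ≤ (m - P) * ((P + 0.36) * (5 / 6)) := by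
      refine mul_le_mul hnm ?_ hp.le (by linarith)
      rw [hP]; linarith [sq_nonneg (p - 0.6)]
    have h7 : A * (0.87 * V - 0.43 * ((m - P) * P)) ≤ (m - P) * ((P + 0.36) * (5 / 6)) := by
      have := mul_le_mul_of_nonneg_left h5 hA.le
      linarith
    have h8 : 0 < 0.87 * V - 0.43 * ((m - P) * P) := by nlinarith [sq_nonneg (m - 2 * P)]
    have h9 := mul_le_mul_of_nonneg_right hc.le h8.le
    nlinarith [sq_nonneg (P - 0.6)]
  have hPm : P ≤ m := by linarith
  have hp1 : p ≤ 1.075 := by nlinarith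
  have h1 : n * ξ ≤ 0.334 := by
    have := mul_le_mul_of_nonneg_right hn hξ
    nlinarith [sq_nonneg (m - P - 2 * ξ)]
  have hAp : A * p ≤ 1.2 * p := mul_le_mul_of_nonneg_right hA2 hp.le
  have h2 : 0.79 ≤ m + P - A * p := by rw [hP]; nlinarith [sq_nonneg (p - 0.6)]
  have h13 := excess_product_le (m := m) (P := P) hθ hQE hEθ hQ (by linarith)
    (by positivity) (by linarith) (by linarith) hV
  have h3 : 1.04 ≤ Q - A * p := by linarith
  have h4 : 1.04 * 0.79 ≤ (Q - A * p) * (m + P - A * p) :=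
    mul_le_mul h3 h2 (by norm_num) (by linarith)
  have h5 : 0 < L ^ 2 - E * L * (A * p * ω) := by
    by_contra! hc
    nlinarith [mul_nonneg (show 0 ≤ Q by linarith) (neg_nonneg.2 hc)]
  have h6 := mul_le_mul_of_nonneg_right hQE h5.le
  linarith

theorem weighted_sum_ge {A B C E X : ℝ} (hB : 0 < B) (hC : 0 < C) (hsA : B + C < A) :
    A ^ 2 * (E ^ 2 + 3 / 8 * ((B + C) * X) ^ 2) ≤
      (A ^ 2 - B ^ 2) * (E ^ 2 + C ^ 2 * X ^ 2 + (A - C) ^ 2)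
        + (A ^ 2 - C ^ 2) * (E ^ 2 + B ^ 2 * X ^ 2 + (A - B) ^ 2) := by
  have hA : 0 < A := by linarith
  have hs : (B + C) ^ 2 ≤ A ^ 2 := pow_le_pow_left₀ (by positivity) hsA.le 2
  have hBC := mul_pos hB hC
  have h1 : 0 ≤ (A ^ 2 - B ^ 2 - C ^ 2) * E ^ 2 := mul_nonneg (by linarith) (by positivity)
  have h2 : 0 ≤ (A ^ 2 * (B ^ 2 + C ^ 2) - 2 * (B * C) ^ 2
      - 3 / 8 * (A ^ 2 * (B + C) ^ 2)) * X ^ 2 := by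
    refine mul_nonneg ?_ (by positivity)
    have h3 : 2 * (B * C) ^ 2 ≤ A ^ 2 * (B + C) ^ 2 / 8 := by
      have h4 : 4 * (B * C) ≤ (B + C) ^ 2 := by linarith [sq_nonneg (B - C)]
      have h5 : 4 * (B * C) * (4 * (B * C)) ≤ (B + C) ^ 2 * A ^ 2 :=
        mul_le_mul h4 (h4.trans hs) (by positivity) (by positivity)
      linarith
    have h6 : 0 ≤ A ^ 2 * (B - C) ^ 2 := by positivity
    linarith
  have h3 : 0 ≤ (A ^ 2 - B ^ 2) * (A - C) ^ 2 :=
    mul_nonneg (by nlinarith) (by positivity)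
  have h4 : 0 ≤ (A ^ 2 - C ^ 2) * (A - B) ^ 2 :=
    mul_nonneg (by nlinarith) (by positivity)
  linarith

theorem unfavourable_le_weighted_sum {A B C E X : ℝ} (hB : 0 < B) (hC : 0 < C)
    (hsA : B + C < A) :
    A * (E ^ 2 * (A - (B + C)) + A * (A - C) * (A - B)) ≤ 2 / 3 *
      ((A ^ 2 - B ^ 2) * (E ^ 2 + C ^ 2 * X ^ 2 + (A - C) ^ 2)
        + (A ^ 2 - C ^ 2) * (E ^ 2 + B ^ 2 * X ^ 2 + (A - B) ^ 2)) := by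
  have hA : 0 < A := by linarith
  have hs : (B + C) ^ 2 ≤ A ^ 2 := pow_le_pow_left₀ (by positivity) hsA.le 2
  have hsA' : 0 ≤ (B + C) * (A - (B + C)) := mul_nonneg (by positivity) (by linarith)
  have hBC := mul_pos hB hC
  have h1 : 0 ≤ (2 / 3 * (2 * A ^ 2 - B ^ 2 - C ^ 2) - A * (A - (B + C))) * E ^ 2 :=
    mul_nonneg (by nlinarith [sq_nonneg A]) (by positivity)
  have h2 : 0 ≤ (A ^ 2 - 4 * (B * C)) * ((A - B) * (A - C)) :=
    mul_nonneg (by linarith [sq_nonneg (B - C)]) (mul_nonneg (by linarith) (by linarith))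
  have h3 : 0 ≤ (A ^ 2 - B ^ 2) * (C ^ 2 * X ^ 2) :=
    mul_nonneg (by nlinarith) (by positivity)
  have h4 : 0 ≤ (A ^ 2 - C ^ 2) * (B ^ 2 * X ^ 2) :=
    mul_nonneg (by nlinarith) (by positivity)
  linarith

theorem sq_sub_sq_ge {A B C : ℝ} (hC : 0 < C) (hCB : C ≤ B) (hA : 1.2 < A)
    (hvol : A * B * C ≤ 0.2215) : 0.87 * A ^ 2 ≤ A ^ 2 - C ^ 2 := by
  have hA0 : 0 < A := by linarith
  have h1 : A * C * C ≤ 0.2215 := by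
    have := mul_le_mul_of_nonneg_left hCB (mul_pos hA0 hC).le
    linarith
  have h2 : 1.728 ≤ A ^ 3 := by
    have := pow_le_pow_left₀ (by norm_num) hA.le 3
    norm_num at this ⊢
    linarith
  have h3 : A * C ^ 2 ≤ A * (0.13 * A ^ 2) := by linarith
  linarith [le_of_mul_le_mul_left h3 hA0]

namespace EinsteinSystem

variable {m A B C D E F X Y Z W G p y w z g : ℝ}

theorem false_of_largest_of_lt (h : EinsteinSystem m A B C D E E X Y Z W G p y w z g)
    (hm : 0 < m) (hm2 : m ^ 2 = 4 / 3) (hp : 0 < p) (hX : 0 < X) (hBC : B ≠ C)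
    (hsA : B + C < A) : False := by
  have hm1 : 1.1547 < m := by nlinarith
  have hm3 : m < 1.15471 := by nlinarith
  have hA := h.hA
  have hB := h.hB
  have hC := h.hC
  have hE := h.hE
  obtain ⟨ω, hω, hV, hθ, hu, ht, hf⟩ := h.exists_coupling_of_E_eq_F hp hX hBC
  have hn := h.V1
  rw [hu, ht] at hn
  have h1 := mul_le_mul_of_nonneg_left (weighted_sum_ge (E := E) (X := X) hB hC hsA) hω
  have h2 := mul_le_mul_of_nonneg_left (unfavourable_le_weighted_sum (E := E) (X := X) hB hC hsA)
    (show 0 ≤ (B + C) * ω by positivity)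
  have hn0 : 0 ≤ ω * (A ^ 2 * (E ^ 2 + 3 / 8 * ((B + C) * X) ^ 2)) := by positivity
  refine false_of_largest_bounds_of_lt (s := B + C) (n := m - p ^ 2 - A ^ 2 + (B - C) ^ 2)
    (L := (B + C) * X) hm1 hm3 hA (by positivity) hsA hp hE (by positivity) rfl rfl hθ ?_ rfl
    hV ?_ ?_ ?_ ?_ ?_
  · linarith [h.D_mul_excess, sq_nonneg (E - D)]
  · have hτ : 0 ≤ (A - C) ^ 2 * (Y ^ 2 + G ^ 2) + (A - B) ^ 2 * (W ^ 2 + Z ^ 2) := by positivity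
    have : 0 ≤ A * (A - (B + C)) := mul_nonneg hA.le (by linarith)
    linarith [h.coupling_mul, h.V1, h.V2, h.V3]
  · linarith
  · linarith [mul_pos hB hC]
  · linarith
  · have h3 : 0 ≤ A * ((B + C) * (ω * (A * X ^ 2 * (A * (B + C) - B * C)))) := by
      have : 0 ≤ A * (B + C) - B * C := by
        linarith [mul_pos hA hC, mul_nonneg hB.le (show 0 ≤ A - C by linarith)]
      positivity
    have h4 : A * (((B + C) * X) ^ 2 - E * ((B + C) * X) * (A * p * ω)) =
        A * ((B + C) * (A - (B + C))) - A * ((B + C) * (ω * (E ^ 2 * (B + C - A)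
        + A * X ^ 2 * (A * (B + C) - B * C) + A * (A - C) * (B - A)))) := by
      linear_combination A * hf
    have h5 : (B + C) * (m - p ^ 2 - A ^ 2 + (B - C) ^ 2) = (B + C) *
        ((A ^ 2 - B ^ 2) * (ω * (E ^ 2 + C ^ 2 * X ^ 2 + (A - C) ^ 2))
        + (A ^ 2 - C ^ 2) * (ω * (E ^ 2 + B ^ 2 * X ^ 2 + (A - B) ^ 2))) := by
      linear_combination (B + C) * hn
    rw [h4, h5]
    linarith

theorem false_of_largest_of_le (h : EinsteinSystem m A B C D E E X Y Z W G p y w z g)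
    (hm : 0 < m) (hm2 : m ^ 2 = 4 / 3) (hp : 0 < p) (hX : 0 < X) (hCB : C < B) (hBA : B ≤ A)
    (hsA : A ≤ B + C) : False := by
  have hm1 : 1.1547 < m := by nlinarith
  have hm3 : m < 1.15471 := by nlinarith
  have hA := h.hA
  have hB := h.hB
  have hC := h.hC
  have hE := h.hE
  obtain ⟨ω, hω, hV, hθ, hu, ht, hf⟩ := h.exists_coupling_of_E_eq_F hp hX hCB.ne'
  have hn := h.V1
  rw [hu, ht] at hn
  have hAB2 : 0 ≤ A ^ 2 - B ^ 2 := sub_nonneg.2 (pow_le_pow_left₀ hB.le hBA 2)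
  have hAC2 : 0 ≤ A ^ 2 - C ^ 2 := sub_nonneg.2 (pow_le_pow_left₀ hC.le (hCB.le.trans hBA) 2)
  have h1 : 0 ≤ (A ^ 2 - B ^ 2) * (ω * (E ^ 2 + C ^ 2 * X ^ 2 + (A - C) ^ 2)) := by positivity
  have h2 : 0 ≤ (A ^ 2 - C ^ 2) * (ω * (A - B) ^ 2) := by positivity
  have h3 : 0 ≤ (A ^ 2 - C ^ 2) * (ω * (B ^ 2 * X ^ 2)) := by positivity
  have h4 : 0 ≤ (A ^ 2 - C ^ 2) * (ω * E ^ 2) := by positivity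
  have hn1 : (A ^ 2 - C ^ 2) * (ω * E ^ 2) ≤ m - p ^ 2 - A ^ 2 + (B - C) ^ 2 := by linarith
  refine false_of_largest_bounds_of_le (ξ := 2 * A * (A - B))
    (n := m - p ^ 2 - A ^ 2 + (B - C) ^ 2) (L := (B + C) * X) hm1 hm3 hA hp hE
    (by positivity) rfl rfl hθ ?_ rfl hV ?_ ?_ ?_ ?_ ?_ ?_
  · linarith [h.D_mul_excess, sq_nonneg (E - D)]
  · have hτ : 0 ≤ (A - C) ^ 2 * (Y ^ 2 + G ^ 2) + (A - B) ^ 2 * (W ^ 2 + Z ^ 2) := by positivity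
    linarith [h.coupling_mul, h.sum_vertical, h.heron_vertical_le hm hm2]
  · exact mul_nonneg (by positivity) (by linarith)
  · linarith
  · have h5 : 0 ≤ (B + C - A) * A := mul_nonneg (by linarith) hA.le
    have h6 : 0 ≤ (A - B + C) * (B - C) := mul_nonneg (by linarith) (by linarith)
    linarith
  · intro hA2
    have hvol := h.volume_le hm hm2
    have h5 := sq_sub_sq_ge hC hCB.le hA2 hvol
    have h6 : ((B + C) * X) ^ 2 / 4 ≤ B ^ 2 * X ^ 2 := by
      have : (B + C) * X ≤ 2 * (B * X) := by linarith [mul_le_mul_of_nonneg_right hCB.le hX.le]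
      have := pow_le_pow_left₀ (by positivity) this 2
      linarith
    have h7 : 0.87 * A ^ 2 * (ω * (E ^ 2 + ((B + C) * X) ^ 2 / 4)) ≤
        (A ^ 2 - C ^ 2) * (ω * (E ^ 2 + B ^ 2 * X ^ 2)) := by gcongr
    linarith
  · have hBC0 : 0 ≤ A * (B + C) - B * C := by
      linarith [mul_pos hA hC, mul_nonneg hB.le (show 0 ≤ A - C by linarith)]
    have h5 : 0 ≤ (B + C) * (ω * (A * X ^ 2 * (A * (B + C) - B * C))) := by positivity
    have h6 : 0 ≤ (B + C) * (ω * (E ^ 2 * (B + C - A))) :=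
      mul_nonneg (by positivity) (mul_nonneg hω (mul_nonneg (by positivity) (by linarith)))
    have h7 : 0 ≤ (B + C) * (B + C - A) := mul_nonneg (by positivity) (by linarith)
    have h8 : ((B + C) * X) ^ 2 - E * ((B + C) * X) * (A * p * ω) ≤
        (B + C) * (ω * (A * (A - C) * (A - B))) := by linarith
    have hAB : 0 ≤ A - B := by linarith
    have hAC : 0 ≤ A - C := by linarith
    have h9 : A * (A - C) ≤ A ^ 2 - C ^ 2 := by linarith [mul_nonneg hC.le hAC]
    calc E ^ 2 * (((B + C) * X) ^ 2 - E * ((B + C) * X) * (A * p * ω))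
        ≤ E ^ 2 * ((B + C) * (ω * (A * (A - C) * (A - B)))) := by gcongr
      _ = A * (A - C) * (ω * E ^ 2) * ((B + C) * (A - B)) := by ring
      _ ≤ (A ^ 2 - C ^ 2) * (ω * E ^ 2) * (2 * A * (A - B)) := by
        gcongr
        linarith
      _ ≤ _ := by gcongr

theorem false_of_pos (h : EinsteinSystem m A B C D E F X Y Z W G p y w z g)
    (hm : 0 < m) (hm2 : m ^ 2 = 4 / 3) (hp : 0 < p) (hX : 0 < X) : False := by
  by_cases hWG : W ≠ 0 ∨ -G ≠ 0
  swap
  · push Not at hWG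
    obtain ⟨rfl, hG⟩ := hWG
    obtain rfl : G = 0 := by linarith
    exact h.false_of_diagonal hm hm2
  by_cases hYZ : Y ≠ 0 ∨ Z ≠ 0
  swap
  · push Not at hYZ
    obtain ⟨rfl, rfl⟩ := hYZ
    have h' := h.swap
    rw [neg_zero] at h'
    exact h'.false_of_diagonal hm hm2
  by_cases hBC : B = C
  · subst hBC
    exact h.false_of_B_eq_C hm hm2 hp hX
  obtain rfl := h.E_eq_F hm hm2 hp hX hYZ hWG hBC
  rcases lt_or_ge (B + C) A with hs | hs
  · exact h.false_of_largest_of_lt hm hm2 hp hX hBC hs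
  rcases le_total A B with h1 | h1 <;> rcases le_total A C with h2 | h2
  · exact h.false_of_smallest hm hm2 h1 h2
  · exact h.false_of_middle hm hp hX hBC h2 h1
  · exact h.swap.false_of_middle hm hp hX (Ne.symm hBC) h1 h2
  · rcases lt_or_gt_of_ne hBC with h3 | h3
    · exact h.swap.false_of_largest_of_le hm hm2 hp hX h3 h2 (by linarith)
    · exact h.false_of_largest_of_le hm hm2 hp hX h3 h1 hs

theorem false_of_sq_eq (h : EinsteinSystem m A B C D E F X Y Z W G p y w z g)
    (hm : 0 < m) (hm2 : m ^ 2 = 4 / 3) : False := by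
  rcases pos_and_pos_or_neg_and_neg_of_mul_pos (h.p_mul_X_pos hm hm2) with ⟨hp, hX⟩ | ⟨hp, hX⟩
  · exact h.false_of_pos hm hm2 hp hX
  · exact h.neg.false_of_pos hm hm2 (by linarith) (by linarith)

end EinsteinSystem

/-- For `μ ∈ {0, 1, 5/(3√3), 2/√3, -2/√3}` the system (S2) has no real solution
with positive `A,…,F`. -/
theorem systemS2_no_solutions_for_special_mu (μ : ℝ)
    (hμ : μ = 0 ∨ μ = 1 ∨ μ = 5/(3*Real.sqrt 3) ∨
      μ = 2/Real.sqrt 3 ∨ μ = -2/Real.sqrt 3) :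
    ¬ ∃ A B C D E F X Y Z W 𝒞 : ℝ,
      0 < A ∧ 0 < B ∧ 0 < C ∧ 0 < D ∧ 0 < E ∧ 0 < F ∧
      SystemS2 A B C D E F X Y Z W 𝒞 μ := by
  rintro ⟨A, B, C, D, E, F, X, Y, Z, W, G, hA, hB, hC, hD, hE, hF, h⟩
  have h' := h.einsteinSystem hA hB hC hD hE hF
  have h3 : 0 < Real.sqrt 3 := by positivity
  have hneg : ∀ μ : ℝ, 0 ≤ μ → -μ ≤ 0 := fun _ => neg_nonpos.2
  rcases hμ with rfl | rfl | rfl | rfl | rfl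
  · exact h'.false_of_nonpos (hneg _ le_rfl)
  · exact h'.false_of_nonpos (hneg _ zero_le_one)
  · exact h'.false_of_nonpos (hneg _ (by positivity))
  · exact h'.false_of_nonpos (hneg _ (by positivity))
  · rw [neg_div, neg_neg] at h'
    refine h'.false_of_sq_eq (by positivity) ?_
    rw [div_pow, Real.sq_sqrt (by norm_num)]
    norm_num
end

section
/- Let (A,B,C,D,E,F) ∈ (ℝ_{>0})⁶ and (X,Y,Z,U,V,W,𝒜,ℬ,𝒞) ∈ ℝ⁹, and set a=√(BC), b=√(AC), c=√(AB), d=√(EF), e=√(DF), f=√(DE), x=X√(BC), u=U√(AC), v=V√(AB), α=𝒜√(BC), y=Y√(AC), w=W√(AB), β=ℬ√(BC), γ=𝒞√(AC), z=Z√(AB). Then the rational expression a²+b²+c²+d²+e²+f²+x²+y²+z²+u²+v²+w²+α²+β²+γ² − (1/2)·[ a²b²/c² + b²c²/a² + c²a²/b² + d²e²/f² + e²f²/d² + f²d²/e² + (a²/c² + c²/a²)(u²+y²+γ²) + (a²/b² + b²/a²)(v²+w²+z²) + (b²/c² + c²/b²)(x²+α²+β²) + a^{−2}((uw−vy−(de/f)β)²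 + (vγ−uz−(df/e)α)² + (yz−wγ−(ef/d)x)²) + b^{−2}((vα−xw−(de/f)γ)² + (xz−vβ−(df/e)y)² + (wβ−zα−(ef/d)u)²) + c^{−2}((xy−uα−(de/f)z)² + (uβ−xγ−(df/e)w)² + (αγ−yβ−(ef/d)v)²) ] equals the polynomial BC+AC+AB+EF+DF+DE + BC(X²+𝒜²+ℬ²) + AC(U²+Y²+𝒞²) + AB(V²+W²+Z²) − (1/2)·( A²+B²+C²+D²+E²+F² + (B²+C²)(X²+𝒜²+ℬ²) + (A²+C²)(U²+Y²+𝒞²) + (A²+B²)(V²+W²+Z²) + (A(YZ−𝒞W)−DX)² + (B(Wℬ−Z𝒜)−DU)² + (C(𝒜𝒞−ℬY)−DV)² + (A(𝒞V−UZ)−E𝒜)² + (B(ZX−Vℬ)−EY)² + (C(ℬU−X𝒞)−EW)² + (A(UW−YV)−Fℬ)² + (B(V𝒜−WX)−F𝒞)² + (C(XY−𝒜U)−FZ)² ). -/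
/-- A positive real number is the square of a positive real number. -/
lemma exists_pos_sq_eq {t : ℝ} (ht : 0 < t) : ∃ s : ℝ, 0 < s ∧ t = s ^ 2 :=
  ⟨√t, Real.sqrt_pos.2 ht, (Real.sq_sqrt ht.le).symm⟩

lemma sqrt_sq_mul_sq {s t : ℝ} (hs : 0 < s) (ht : 0 < t) : √(s ^ 2 * t ^ 2) = s * t := by
  rw [← mul_pow, Real.sqrt_sq (mul_pos hs ht).le]


/-- Under the coordinate change `a=√(BC), b=√(AC), c=√(AB), d=√(EF), e=√(DF),
f=√(DE), x=X√(BC), u=U√(AC), v=V√(AB), α=𝒜√(BC), y=Y√(AC), w=W√(AB),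
β=ℬ√(BC), γ=𝒞√(AC), z=Z√(AB)`, the rational expression for the scalar
curvature `S` of the corresponding left-invariant metric on S³×S³ equals a
polynomial of degree 6 in the new coordinates. -/
theorem scalar_curvature_polynomial_identity
    (A B C D E F X Y Z U V W 𝒜 ℬ 𝒞 : ℝ)
    (hA : 0 < A) (hB : 0 < B) (hC : 0 < C)
    (hD : 0 < D) (hE : 0 < E) (hF : 0 < F)
    (a b c d e f x y z u v w α β γ : ℝ)
    (ha : a = Real.sqrt (B*C)) (hb : b = Real.sqrt (A*C)) (hc : c = Real.sqrt (A*B))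
    (hd : d = Real.sqrt (E*F)) (he : e = Real.sqrt (D*F)) (hf : f = Real.sqrt (D*E))
    (hx : x = X * Real.sqrt (B*C)) (hu : u = U * Real.sqrt (A*C))
    (hv : v = V * Real.sqrt (A*B)) (hα : α = 𝒜 * Real.sqrt (B*C))
    (hy : y = Y * Real.sqrt (A*C)) (hw : w = W * Real.sqrt (A*B))
    (hβ : β = ℬ * Real.sqrt (B*C)) (hγ : γ = 𝒞 * Real.sqrt (A*C))
    (hz : z = Z * Real.sqrt (A*B)) :
    a^2 + b^2 + c^2 + d^2 + e^2 + f^2 + x^2 + y^2 + z^2 + u^2 + v^2 + w^2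
      + α^2 + β^2 + γ^2
    - (1/2) * ( a^2*b^2/c^2 + b^2*c^2/a^2 + c^2*a^2/b^2
      + d^2*e^2/f^2 + e^2*f^2/d^2 + f^2*d^2/e^2
      + (a^2/c^2 + c^2/a^2) * (u^2 + y^2 + γ^2)
      + (a^2/b^2 + b^2/a^2) * (v^2 + w^2 + z^2)
      + (b^2/c^2 + c^2/b^2) * (x^2 + α^2 + β^2)
      + ((u*w - v*y - (d*e/f)*β)^2 + (v*γ - u*z - (d*f/e)*α)^2
          + (y*z - w*γ - (e*f/d)*x)^2) / a^2
      + ((v*α - x*w - (d*e/f)*γ)^2 + (x*z - v*β - (d*f/e)*y)^2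
          + (w*β - z*α - (e*f/d)*u)^2) / b^2
      + ((x*y - u*α - (d*e/f)*z)^2 + (u*β - x*γ - (d*f/e)*w)^2
          + (α*γ - y*β - (e*f/d)*v)^2) / c^2 )
    =
    B*C + A*C + A*B + E*F + D*F + D*E
      + B*C*(X^2 + 𝒜^2 + ℬ^2) + A*C*(U^2 + Y^2 + 𝒞^2) + A*B*(V^2 + W^2 + Z^2)
    - (1/2) * ( A^2 + B^2 + C^2 + D^2 + E^2 + F^2
      + (B^2 + C^2)*(X^2 + 𝒜^2 + ℬ^2)
      + (A^2 + C^2)*(U^2 + Y^2 + 𝒞^2)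
      + (A^2 + B^2)*(V^2 + W^2 + Z^2)
      + (A*(Y*Z - 𝒞*W) - D*X)^2 + (B*(W*ℬ - Z*𝒜) - D*U)^2
      + (C*(𝒜*𝒞 - ℬ*Y) - D*V)^2
      + (A*(𝒞*V - U*Z) - E*𝒜)^2 + (B*(Z*X - V*ℬ) - E*Y)^2
      + (C*(ℬ*U - X*𝒞) - E*W)^2
      + (A*(U*W - Y*V) - F*ℬ)^2 + (B*(V*𝒜 - W*X) - F*𝒞)^2
      + (C*(X*Y - 𝒜*U) - F*Z)^2 ) := by
  obtain ⟨p, hp, rfl⟩ := exists_pos_sq_eq hA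
  obtain ⟨q, hq, rfl⟩ := exists_pos_sq_eq hB
  obtain ⟨r, hr, rfl⟩ := exists_pos_sq_eq hC
  obtain ⟨k, hk, rfl⟩ := exists_pos_sq_eq hD
  obtain ⟨l, hl, rfl⟩ := exists_pos_sq_eq hE
  obtain ⟨m, hm, rfl⟩ := exists_pos_sq_eq hF
  rw [sqrt_sq_mul_sq hq hr] at ha hx hα hβ
  rw [sqrt_sq_mul_sq hp hr] at hb hu hy hγ
  rw [sqrt_sq_mul_sq hp hq] at hc hv hw hz
  rw [sqrt_sq_mul_sq hl hm] at hd
  rw [sqrt_sq_mul_sq hk hm] at he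
  rw [sqrt_sq_mul_sq hk hl] at hf
  have hdef : d * e / f = m ^ 2 := by subst hd he hf; field_simp
  have hdfe : d * f / e = l ^ 2 := by subst hd he hf; field_simp
  have hefd : e * f / d = k ^ 2 := by subst hd he hf; field_simp
  rw [hdef, hdfe, hefd]
  subst ha hb hc hd he hf hx hu hv hα hy hw hβ hγ hz
  field_simp
  ring
end

section
/- Let σ₁, σ₂ ∈ SO(3) and let σ be the 6×6 block-diagonal matrix with diagonal blocks σ₁ and σ₂. Assume σ has finite order and σ² ≠ 1. Then for every positive-definite symmetric real 6×6 matrix G with σᵀGσ = G, there exists a nonzero 6×6 block-diagonal matrix ξ, whose diagonal blocks are skew-symmetric 3×3 real matrices, such that ξᵀG + Gξ = 0. (Equivalently: every inner product on ℝ³⊕ℝ³ invariant under σ is invariant under a nontrivial one-parameter subgroup exp(tξ) of SO(3)×SO(3).) -/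
open Matrix

/-- If `σ = diag(σ₁,σ₂)` with `σ₁,σ₂ ∈ SO(3)` has finite order and `σ² ≠ 1`, then
every `σ`-invariant inner product `G` on `ℝ³⊕ℝ³` admits a nonzero infinitesimal
isometry `ξ = diag(ξ₁,ξ₂)` with skew-symmetric blocks, i.e. `ξᵀG + Gξ = 0`. -/
theorem invariant_metric_has_infinitesimal_isometry
    (σ₁ σ₂ : Matrix (Fin 3) (Fin 3) ℝ)
    (hσ₁o : σ₁ᵀ * σ₁ = 1) (hσ₁d : σ₁.det = 1)
    (hσ₂o : σ₂ᵀ * σ₂ = 1) (hσ₂d : σ₂.det = 1)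
    (hfin : ∃ n : ℕ, 0 < n ∧ (fromBlocks σ₁ 0 0 σ₂) ^ n = 1)
    (hnotinv : (fromBlocks σ₁ 0 0 σ₂) ^ 2 ≠ 1)
    (G : Matrix (Fin 3 ⊕ Fin 3) (Fin 3 ⊕ Fin 3) ℝ)
    (hG : G.PosDef)
    (hGinv : (fromBlocks σ₁ 0 0 σ₂)ᵀ * G * (fromBlocks σ₁ 0 0 σ₂) = G) :
    ∃ ξ₁ ξ₂ : Matrix (Fin 3) (Fin 3) ℝ,
      ξ₁ᵀ = -ξ₁ ∧ ξ₂ᵀ = -ξ₂ ∧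
      fromBlocks ξ₁ 0 0 ξ₂ ≠ 0 ∧
      (fromBlocks ξ₁ 0 0 ξ₂)ᵀ * G + G * fromBlocks ξ₁ 0 0 ξ₂ = 0 := by
  have hblock : fromBlocks (σ₁ - σ₁ᵀ) 0 0 (σ₂ - σ₂ᵀ) =
      fromBlocks σ₁ 0 0 σ₂ - (fromBlocks σ₁ 0 0 σ₂)ᵀ := by
    simp [fromBlocks_transpose, sub_eq_add_neg, fromBlocks_neg, fromBlocks_add]
  have horth : (fromBlocks σ₁ 0 0 σ₂)ᵀ * fromBlocks σ₁ 0 0 σ₂ = 1 := by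
    simp [fromBlocks_transpose, fromBlocks_multiply, hσ₁o, hσ₂o]
  refine ⟨σ₁ - σ₁ᵀ, σ₂ - σ₂ᵀ, by simp, by simp, ?_, ?_⟩
  all_goals
    rw [hblock]
    generalize fromBlocks σ₁ 0 0 σ₂ = σ at *
  · intro h
    rw [← sub_eq_zero.mp h] at horth
    exact hnotinv (by rw [pow_two, horth])
  · have hleft : σᵀ * G = G * σᵀ := by
      conv_rhs => rw [← hGinv]
      rw [Matrix.mul_assoc _ σ, mul_eq_one_comm.mp horth, Matrix.mul_one]
    have hright : σ * G = G * σ := by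
      conv_lhs => rw [← hGinv]
      rw [← Matrix.mul_assoc, ← Matrix.mul_assoc, mul_eq_one_comm.mp horth, Matrix.one_mul]
    rw [transpose_sub, transpose_transpose, Matrix.sub_mul, Matrix.mul_sub, hleft, hright]
    abel
end

section
/- Let θ₁, θ₂ ∈ ℝ with cos θ₂ ≠ 1, cos θ₂ ≠ −1, and cos θ₁ ≠ cos θ₂. Let σ be the 6×6 block-diagonal matrix with diagonal blocks R₃(θ₁) and R₃(θ₂). Then every positive-definite symmetric real 6×6 matrix G satisfying σᵀGσ = G also satisfies ρ(φ)ᵀ G ρ(φ) = G for all φ ∈ ℝ, where ρ(φ) is the 6×6 block-diagonal matrix with diagonal blocks I₃ and R₃(φ). -/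
open Matrix

/-- The rotation matrix `R₃(θ)` about the third axis. -/
noncomputable def rot3 (θ : ℝ) : Matrix (Fin 3) (Fin 3) ℝ :=
  !![Real.cos θ, -Real.sin θ, 0;
     Real.sin θ, Real.cos θ, 0;
     0, 0, 1]

theorem rot3_transpose_mul_self (θ : ℝ) : (rot3 θ)ᵀ * rot3 θ = 1 := by
  ext i j
  fin_cases i <;> fin_cases j <;>
    simp [rot3, Matrix.mul_apply, Fin.sum_univ_three] <;>
    linarith [Real.sin_sq_add_cos_sq θ]

theorem rot3_mul_transpose_self (θ : ℝ) : rot3 θ * (rot3 θ)ᵀ = 1 :=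
  mul_eq_one_comm.mp (rot3_transpose_mul_self θ)

theorem rot3_add_transpose (θ : ℝ) :
    rot3 θ + (rot3 θ)ᵀ = diagonal ![2 * Real.cos θ, 2 * Real.cos θ, 2] := by
  ext i j
  fin_cases i <;> fin_cases j <;> simp [rot3] <;> ring

/-- A matrix fixed by `M ↦ R₃(α)ᵀ M R₃(β)` intertwines `R₃(β)` and `R₃(α)`. -/
theorem mul_rot3_eq_of_invariant {α β : ℝ} {M : Matrix (Fin 3) (Fin 3) ℝ}
    (h : (rot3 α)ᵀ * M * rot3 β = M) : M * rot3 β = rot3 α * M := by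
  calc M * rot3 β = rot3 α * (rot3 α)ᵀ * (M * rot3 β) := by
        rw [rot3_mul_transpose_self, one_mul]
    _ = rot3 α * ((rot3 α)ᵀ * M * rot3 β) := by simp only [mul_assoc]
    _ = rot3 α * M := by rw [h]

theorem mul_rot3_transpose_eq_of_invariant {α β : ℝ} {M : Matrix (Fin 3) (Fin 3) ℝ}
    (h : (rot3 α)ᵀ * M * rot3 β = M) : M * (rot3 β)ᵀ = (rot3 α)ᵀ * M := by
  calc M * (rot3 β)ᵀ = (rot3 α)ᵀ * M * rot3 β * (rot3 β)ᵀ := by rw [h]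
    _ = (rot3 α)ᵀ * M := by rw [mul_assoc, rot3_mul_transpose_self, mul_one]

/-- Entries of an invariant matrix vanish wherever the eigenvalues of the symmetrized
rotations `R₃(α) + R₃(α)ᵀ` and `R₃(β) + R₃(β)ᵀ` differ. -/
theorem apply_eq_zero_of_invariant {α β : ℝ} {M : Matrix (Fin 3) (Fin 3) ℝ}
    (h : (rot3 α)ᵀ * M * rot3 β = M) {i j : Fin 3}
    (hij : ![2 * Real.cos α, 2 * Real.cos α, 2] i ≠ ![2 * Real.cos β, 2 * Real.cos β, 2] j) :
    M i j = 0 := by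
  have key : M * (rot3 β + (rot3 β)ᵀ) = (rot3 α + (rot3 α)ᵀ) * M := by
    rw [mul_add, add_mul, mul_rot3_eq_of_invariant h, mul_rot3_transpose_eq_of_invariant h]
  rw [rot3_add_transpose, rot3_add_transpose] at key
  have e := congrFun₂ key i j
  rw [mul_diagonal, diagonal_mul, mul_comm] at e
  by_contra hM
  exact hij (mul_right_cancel₀ hM e).symm

theorem mul_rot3_eq_self_of_invariant {α β : ℝ} (hβ : Real.cos β ≠ 1)
    (hαβ : Real.cos α ≠ Real.cos β) {M : Matrix (Fin 3) (Fin 3) ℝ}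
    (h : (rot3 α)ᵀ * M * rot3 β = M) (φ : ℝ) : M * rot3 φ = M := by
  have col (i j : Fin 3) (hj : j ≠ 2) : M i j = 0 := by
    apply apply_eq_zero_of_invariant h
    fin_cases i <;> fin_cases j <;> simp_all [eq_comm]
  have h0 (i : Fin 3) : M i 0 = 0 := col i 0 (by decide)
  have h1 (i : Fin 3) : M i 1 = 0 := col i 1 (by decide)
  ext i j
  fin_cases j <;> simp [rot3, Matrix.mul_apply, Fin.sum_univ_three, h0, h1]

theorem rot3_conj_eq_self_of_invariant {β : ℝ} (hp : Real.cos β ≠ 1)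
    (hm : Real.cos β ≠ -1) {M : Matrix (Fin 3) (Fin 3) ℝ}
    (h : (rot3 β)ᵀ * M * rot3 β = M) (φ : ℝ) : (rot3 φ)ᵀ * M * rot3 φ = M := by
  have hs : Real.sin β ≠ 0 := fun hs =>
    (Real.sin_eq_zero_iff_cos_eq.mp hs).elim hp hm
  have h02 : M 0 2 = 0 := apply_eq_zero_of_invariant h (by simpa using hp)
  have h12 : M 1 2 = 0 := apply_eq_zero_of_invariant h (by simpa using hp)
  have h20 : M 2 0 = 0 := apply_eq_zero_of_invariant h (by simpa [eq_comm] using hp)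
  have h21 : M 2 1 = 0 := apply_eq_zero_of_invariant h (by simpa [eq_comm] using hp)
  have comm := mul_rot3_eq_of_invariant h
  have e00 := congrFun₂ comm 0 0
  have e01 := congrFun₂ comm 0 1
  simp only [rot3, Matrix.mul_apply, Fin.sum_univ_three] at e00 e01
  simp at e00 e01
  have h10 : M 1 0 = -M 0 1 := mul_left_cancel₀ hs (by linarith)
  have h11 : M 1 1 = M 0 0 := mul_left_cancel₀ hs (by linarith)
  suffices M * rot3 φ = rot3 φ * M by
    rw [mul_assoc, this, ← mul_assoc, rot3_transpose_mul_self, one_mul]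
  ext i j
  fin_cases i <;> fin_cases j <;>
    simp [rot3, Matrix.mul_apply, Fin.sum_univ_three, h02, h12, h20, h21, h10, h11] <;> ring

/-- If `σ = diag(R₃(θ₁), R₃(θ₂))` with `cos θ₂ ≠ ±1` and `cos θ₁ ≠ cos θ₂`, then
every `σ`-invariant positive-definite symmetric `G` on `ℝ³⊕ℝ³` is invariant
under the circle `φ ↦ diag(I₃, R₃(φ))`. -/
theorem invariance_inequivalent_rotations
    (θ₁ θ₂ : ℝ)
    (h₂p : Real.cos θ₂ ≠ 1) (h₂m : Real.cos θ₂ ≠ -1)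
    (h₁₂ : Real.cos θ₁ ≠ Real.cos θ₂)
    (G : Matrix (Fin 3 ⊕ Fin 3) (Fin 3 ⊕ Fin 3) ℝ)
    (hG : G.PosDef)
    (hGinv : (fromBlocks (rot3 θ₁) 0 0 (rot3 θ₂))ᵀ * G *
      fromBlocks (rot3 θ₁) 0 0 (rot3 θ₂) = G) :
    ∀ φ : ℝ, (fromBlocks 1 0 0 (rot3 φ))ᵀ * G * fromBlocks 1 0 0 (rot3 φ) = G := by
  intro φ
  rw [← fromBlocks_toBlocks G] at hGinv ⊢
  simp only [fromBlocks_transpose, fromBlocks_multiply, transpose_zero, transpose_one,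
    Matrix.zero_mul, Matrix.mul_zero, add_zero, zero_add, Matrix.one_mul, Matrix.mul_one,
    fromBlocks_inj] at hGinv ⊢
  obtain ⟨-, h12, h21, h22⟩ := hGinv
  refine ⟨trivial, mul_rot3_eq_self_of_invariant h₂p h₁₂ h12 φ, ?_,
    rot3_conj_eq_self_of_invariant h₂p h₂m h22 φ⟩
  have h21' : (rot3 θ₁)ᵀ * G.toBlocks₂₁ᵀ * rot3 θ₂ = G.toBlocks₂₁ᵀ := by
    simpa [mul_assoc] using congrArg transpose h21
  simpa using congrArg transpose (mul_rot3_eq_self_of_invariant h₂p h₁₂ h21' φ)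
end

section
/- Let θ ∈ ℝ with cos θ ≠ 1 and cos θ ≠ −1. Let σ be the 6×6 block-diagonal matrix with both diagonal blocks equal to R₃(θ). Then every positive-definite symmetric real 6×6 matrix G satisfying σᵀGσ = G also satisfies ρ(φ)ᵀ G ρ(φ) = G for all φ ∈ ℝ, where ρ(φ) is the 6×6 block-diagonal matrix with both diagonal blocks equal to R₃(φ). (Every σ-invariant inner product on ℝ³⊕ℝ³ is invariant under the diagonally embedded circle subgroup of SO(3)×SO(3).) -/
open Matrix

/-- If `cos θ ≠ ±1`, every `R₃(φ)` is a linear combination of `1`, `R₃(θ)` and `R₃(θ)ᵀ`. -/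
theorem exists_rot3_eq_linear_combination {θ : ℝ} (hp : Real.cos θ ≠ 1) (hm : Real.cos θ ≠ -1)
    (φ : ℝ) : ∃ a b c : ℝ, rot3 φ = a • 1 + b • rot3 θ + c • (rot3 θ)ᵀ := by
  have hs : Real.sin θ ≠ 0 := fun h ↦
    (Real.sin_eq_zero_iff_cos_eq.mp h).elim hp hm
  have hc : 1 - Real.cos θ ≠ 0 := sub_ne_zero.mpr hp.symm
  refine ⟨1 - (1 - Real.cos φ) / (1 - Real.cos θ),
    ((1 - Real.cos φ) / (1 - Real.cos θ) + Real.sin φ / Real.sin θ) / 2,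
    ((1 - Real.cos φ) / (1 - Real.cos θ) - Real.sin φ / Real.sin θ) / 2, ?_⟩
  ext i j
  fin_cases i <;> fin_cases j <;> simp [rot3] <;> field_simp <;> ring

/-- For `P` with left inverse `Pᵀ`, preserving `G` amounts to commuting with `G`. -/
theorem transpose_mul_mul_eq_iff_commute {n : Type*} [Fintype n] [DecidableEq n]
    {P : Matrix n n ℝ} (hP : Pᵀ * P = 1) (G : Matrix n n ℝ) :
    Pᵀ * G * P = G ↔ Commute P G := by
  have hP' : P * Pᵀ = 1 := mul_eq_one_comm.mp hP
  constructor <;> intro h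
  · calc P * G = P * (Pᵀ * G * P) := by rw [h]
      _ = (P * Pᵀ) * G * P := by simp only [Matrix.mul_assoc]
      _ = G * P := by rw [hP', Matrix.one_mul]
  · rw [Matrix.mul_assoc, ← h.eq, ← Matrix.mul_assoc, hP, Matrix.one_mul]

/-- If `σ = diag(R₃(θ), R₃(θ))` with `cos θ ≠ ±1`, then every `σ`-invariant
positive-definite symmetric `G` on `ℝ³⊕ℝ³` is invariant under the diagonally
embedded circle `φ ↦ diag(R₃(φ), R₃(φ))`. -/
theorem invariance_equivalent_rotations
    (θ : ℝ) (hp : Real.cos θ ≠ 1) (hm : Real.cos θ ≠ -1)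
    (G : Matrix (Fin 3 ⊕ Fin 3) (Fin 3 ⊕ Fin 3) ℝ)
    (hG : G.PosDef)
    (hGinv : (fromBlocks (rot3 θ) 0 0 (rot3 θ))ᵀ * G *
      fromBlocks (rot3 θ) 0 0 (rot3 θ) = G) :
    ∀ φ : ℝ, (fromBlocks (rot3 φ) 0 0 (rot3 φ))ᵀ * G *
      fromBlocks (rot3 φ) 0 0 (rot3 φ) = G := by
  intro φ
  have hσ (ψ : ℝ) : (fromBlocks (rot3 ψ) 0 0 (rot3 ψ))ᵀ * fromBlocks (rot3 ψ) 0 0 (rot3 ψ) = 1 := by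
    simp [fromBlocks_transpose, fromBlocks_multiply, rot3_transpose_mul_self]
  have hcomm := (transpose_mul_mul_eq_iff_commute (hσ θ) G).mp hGinv
  have hcommT : Commute (fromBlocks (rot3 θ) 0 0 (rot3 θ))ᵀ G := by
    have h := congrArg transpose hcomm.eq
    rw [transpose_mul, transpose_mul, ← conjTranspose_eq_transpose_of_trivial G,
      hG.isHermitian.eq] at h
    exact h.symm
  obtain ⟨a, b, c, habc⟩ := exists_rot3_eq_linear_combination hp hm φ
  have hρ : fromBlocks (rot3 φ) 0 0 (rot3 φ) = a • 1 + b • fromBlocks (rot3 θ) 0 0 (rot3 θ) +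
      c • (fromBlocks (rot3 θ) 0 0 (rot3 θ))ᵀ := by
    rw [← fromBlocks_one, fromBlocks_transpose]
    simp [fromBlocks_smul, fromBlocks_add, habc, -fromBlocks_one]
  rw [transpose_mul_mul_eq_iff_commute (hσ φ), hρ]
  exact (((Commute.one_left G).smul_left a).add_left (hcomm.smul_left b)).add_left
    (hcommT.smul_left c)
end

section
/- For t ∈ [−1, 1] let s = √(1−t²) and let A_t be the 6×6 real matrix with block form A_t = [[I₃, 0],[W_t, I₃]], where W_t = [[−1, 0, 0],[0, t, s],[0, s, −t]]. Then for every t ∈ [−1, 1] there exists ρ ∈ SO(3) such that W_t = ρ W₀ ρᵀ, and consequently A_t = P A₀ Pᵀ, where P is the 6×6 block-diagonal matrix with both diagonal blocks equal to ρ. (Hence all members of the one-parameter family of ℤ₂-invariant critical metrics with μ = −1 are related by an inner automorphism of S³×S³, so they are all isometric to each other.) -/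
open Matrix

/-- The off-diagonal block `W_t` of the family of ℤ₂-invariant critical metrics
with `μ = -1`, with `s = √(1-t²)`. -/
noncomputable def Wfam (t : ℝ) : Matrix (Fin 3) (Fin 3) ℝ :=
  !![-1, 0, 0;
     0, t, Real.sqrt (1 - t^2);
     0, Real.sqrt (1 - t^2), -t]

/-- The matrix `A_t = [[I₃,0],[W_t,I₃]]` encoding the metric `g_t`. -/
noncomputable def Afam (t : ℝ) : Matrix (Fin 3 ⊕ Fin 3) (Fin 3 ⊕ Fin 3) ℝ :=
  fromBlocks 1 0 (Wfam t) 1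

/-- The rotation by the angle `φ` about the first coordinate axis. -/
noncomputable def rotX (φ : ℝ) : Matrix (Fin 3) (Fin 3) ℝ :=
  !![1, 0, 0;
     0, Real.cos φ, -Real.sin φ;
     0, Real.sin φ, Real.cos φ]

lemma rotX_transpose_mul_self (φ : ℝ) : (rotX φ)ᵀ * rotX φ = 1 := by
  have h := Real.sin_sq_add_cos_sq φ
  ext i j
  fin_cases i <;> fin_cases j <;>
    simp [rotX, Matrix.mul_apply, Fin.sum_univ_three] <;> linarith

lemma det_rotX (φ : ℝ) : (rotX φ).det = 1 := by
  have h := Real.sin_sq_add_cos_sq φ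
  simp [rotX, Matrix.det_fin_three]
  linarith

lemma rotX_mul_Wfam_zero_mul_transpose (φ : ℝ) :
    rotX φ * Wfam 0 * (rotX φ)ᵀ =
      !![-1, 0, 0;
         0, -Real.sin (2 * φ), Real.cos (2 * φ);
         0, Real.cos (2 * φ), Real.sin (2 * φ)] := by
  rw [Real.sin_two_mul, Real.cos_two_mul']
  ext i j
  fin_cases i <;> fin_cases j <;>
    simp [rotX, Wfam, Matrix.mul_apply, Fin.sum_univ_three] <;> ring

lemma Wfam_eq_rotX_conj {t : ℝ} (ht₁ : -1 ≤ t) (ht₂ : t ≤ 1) :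
    Wfam t = rotX (-(Real.arcsin t / 2)) * Wfam 0 * (rotX (-(Real.arcsin t / 2)))ᵀ := by
  have h : 2 * -(Real.arcsin t / 2) = -Real.arcsin t := by ring
  rw [rotX_mul_Wfam_zero_mul_transpose, h, Real.sin_neg, Real.cos_neg,
    Real.sin_arcsin ht₁ ht₂, Real.cos_arcsin, neg_neg, Wfam]

/-- If an orthogonal `ρ` conjugates `W_s` to `W_t`, then `diag(ρ, ρ)` conjugates `A_s` to `A_t`. -/
lemma Afam_eq_conj_of_Wfam_eq_conj {s t : ℝ} {ρ : Matrix (Fin 3) (Fin 3) ℝ}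
    (hρ : ρᵀ * ρ = 1) (hW : Wfam t = ρ * Wfam s * ρᵀ) :
    Afam t = fromBlocks ρ 0 0 ρ * Afam s * (fromBlocks ρ 0 0 ρ)ᵀ := by
  have hρ' : ρ * ρᵀ = 1 := mul_eq_one_comm.mp hρ
  simp [Afam, fromBlocks_transpose, fromBlocks_multiply, hρ', hW]

/-- For every `t ∈ [-1,1]` there is a rotation `ρ ∈ SO(3)` with
`W_t = ρ W₀ ρᵀ`, and hence `A_t = P A₀ Pᵀ` for `P = diag(ρ,ρ)`: all members of
the one-parameter family of ℤ₂-invariant critical metrics with `μ = -1` are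
related by an inner automorphism of S³×S³. -/
theorem mu_neg_one_family_conjugate (t : ℝ) (ht₁ : -1 ≤ t) (ht₂ : t ≤ 1) :
    ∃ ρ : Matrix (Fin 3) (Fin 3) ℝ,
      ρᵀ * ρ = 1 ∧ ρ.det = 1 ∧
      Wfam t = ρ * Wfam 0 * ρᵀ ∧
      Afam t = fromBlocks ρ 0 0 ρ * Afam 0 * (fromBlocks ρ 0 0 ρ)ᵀ := by
  have hρ := rotX_transpose_mul_self (-(Real.arcsin t / 2))
  have hW := Wfam_eq_rotX_conj ht₁ ht₂
  exact ⟨_, hρ, det_rotX _, hW, Afam_eq_conj_of_Wfam_eq_conj hρ hW⟩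
end

section
/- Let α = 3^{1/4}/√2, β = √2/3^{1/4} and p₀ = 1/(√2·3^{1/4}). For t ∈ [−1/√3, 1/√3] set p = √(1−3t²)/(√2·3^{1/4}), q = 3^{1/4}·t/√2, and let A_t be the 6×6 real matrix with block form A_t = [[α·I₃, 0],[W_t, β·I₃]], where W_t = [[p₀, 0, 0],[0, p, −q],[0, q, p]]. Let ρ_t = [[1, 0, 0],[0, √(1−3t²), −√3·t],[0, √3·t, √(1−3t²)]] ∈ SO(3) and let P_t be the 6×6 block-diagonal matrix with diagonal blocks I₃ and ρ_t. Then for every t ∈ [−1/√3, 1/√3] one has A_tᵀ A_t = P_t (A₀ᵀ A₀) P_tᵀ. (Hence all members of the one-parameter family of ℤ₂-invariant critical metrics with μ = −5/(3√3) are related by an inner automorphism of S³×S³ to the nearly Kähler metric, so they are all isometric to it.) -/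
open Matrix

/-- `α = 3^{1/4}/√2`. -/
noncomputable def alNK : ℝ := Real.sqrt (Real.sqrt 3) / Real.sqrt 2

/-- `β = √2/3^{1/4}`. -/
noncomputable def beNK : ℝ := Real.sqrt 2 / Real.sqrt (Real.sqrt 3)

/-- `p₀ = 1/(√2·3^{1/4})`. -/
noncomputable def p0NK : ℝ := 1 / (Real.sqrt 2 * Real.sqrt (Real.sqrt 3))

/-- `p = √(1-3t²)/(√2·3^{1/4})`. -/
noncomputable def pNK (t : ℝ) : ℝ :=
  Real.sqrt (1 - 3*t^2) / (Real.sqrt 2 * Real.sqrt (Real.sqrt 3))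

/-- `q = 3^{1/4}·t/√2`. -/
noncomputable def qNK (t : ℝ) : ℝ := Real.sqrt (Real.sqrt 3) * t / Real.sqrt 2

/-- The off-diagonal block `W_t` of the family of ℤ₂-invariant critical metrics
with `μ = -5/(3√3)`. -/
noncomputable def WfamNK (t : ℝ) : Matrix (Fin 3) (Fin 3) ℝ :=
  !![p0NK, 0, 0;
     0, pNK t, -(qNK t);
     0, qNK t, pNK t]

/-- The matrix `A_t = [[α·I₃,0],[W_t,β·I₃]]` encoding the metric `g_t`. -/
noncomputable def AfamNK (t : ℝ) : Matrix (Fin 3 ⊕ Fin 3) (Fin 3 ⊕ Fin 3) ℝ :=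
  fromBlocks (alNK • (1 : Matrix (Fin 3) (Fin 3) ℝ)) 0 (WfamNK t)
    (beNK • (1 : Matrix (Fin 3) (Fin 3) ℝ))

/-- The rotation `ρ_t`. -/
noncomputable def rhoNK (t : ℝ) : Matrix (Fin 3) (Fin 3) ℝ :=
  !![1, 0, 0;
     0, Real.sqrt (1 - 3*t^2), -(Real.sqrt 3 * t);
     0, Real.sqrt 3 * t, Real.sqrt (1 - 3*t^2)]

/-- The block-diagonal matrix `P_t = diag(I₃, ρ_t)`. -/
noncomputable def PNK (t : ℝ) : Matrix (Fin 3 ⊕ Fin 3) (Fin 3 ⊕ Fin 3) ℝ :=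
  fromBlocks 1 0 0 (rhoNK t)

theorem sqrt_one_sub_three_mul_sq_add {t : ℝ}
    (ht₁ : -(Real.sqrt 3)⁻¹ ≤ t) (ht₂ : t ≤ (Real.sqrt 3)⁻¹) :
    Real.sqrt (1 - 3*t^2) * Real.sqrt (1 - 3*t^2)
      + (Real.sqrt 3 * t) * (Real.sqrt 3 * t) = 1 := by
  have h3 : Real.sqrt 3 * Real.sqrt 3 = 3 := Real.mul_self_sqrt (by norm_num)
  have ht : t ^ 2 ≤ 1 / 3 := by
    have h := sq_le_sq' ht₁ ht₂
    rwa [inv_pow, Real.sq_sqrt (by norm_num), ← one_div] at h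
  rw [Real.mul_self_sqrt (by linarith)]
  linear_combination t ^ 2 * h3

theorem rhoNK_transpose_mul_self {t : ℝ}
    (ht₁ : -(Real.sqrt 3)⁻¹ ≤ t) (ht₂ : t ≤ (Real.sqrt 3)⁻¹) :
    (rhoNK t)ᵀ * rhoNK t = 1 := by
  have h := sqrt_one_sub_three_mul_sq_add ht₁ ht₂
  unfold rhoNK
  generalize Real.sqrt (1 - 3*t^2) = c at *
  generalize Real.sqrt 3 * t = s at *
  ext i j
  fin_cases i <;> fin_cases j <;>
    simp [Matrix.mul_apply, Fin.sum_univ_three] <;> linarith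

theorem det_rhoNK {t : ℝ}
    (ht₁ : -(Real.sqrt 3)⁻¹ ≤ t) (ht₂ : t ≤ (Real.sqrt 3)⁻¹) :
    (rhoNK t).det = 1 := by
  have h := sqrt_one_sub_three_mul_sq_add ht₁ ht₂
  rw [det_fin_three]
  simp only [rhoNK, of_apply, cons_val]
  linear_combination h

/-- The block `W_t` is a multiple of the rotation `ρ_t`. -/
theorem WfamNK_eq_smul_rhoNK (t : ℝ) : WfamNK t = p0NK • rhoNK t := by
  have hp : pNK t = p0NK * Real.sqrt (1 - 3*t^2) := by
    unfold pNK p0NK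
    ring
  have hq : qNK t = p0NK * (Real.sqrt 3 * t) := by
    have h : Real.sqrt (Real.sqrt 3) ^ 2 = Real.sqrt 3 := Real.sq_sqrt (by positivity)
    unfold qNK p0NK
    field_simp
    rw [h, mul_comm]
  simp [WfamNK, rhoNK, hp, hq, smul_of]

theorem rhoNK_zero : rhoNK 0 = 1 := by
  simp [rhoNK, one_fin_three]

/-- For every `t ∈ [-1/√3, 1/√3]`, `ρ_t ∈ SO(3)` and
`A_tᵀ A_t = P_t (A₀ᵀ A₀) P_tᵀ`: all members of the one-parameter family of
ℤ₂-invariant critical metrics with `μ = -5/(3√3)` are related by an inner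
automorphism of S³×S³ to the nearly Kähler metric. -/
theorem mu_nearlyKaehler_family_conjugate (t : ℝ)
    (ht₁ : -(Real.sqrt 3)⁻¹ ≤ t) (ht₂ : t ≤ (Real.sqrt 3)⁻¹) :
    (rhoNK t)ᵀ * rhoNK t = 1 ∧ (rhoNK t).det = 1 ∧
    (AfamNK t)ᵀ * AfamNK t = PNK t * ((AfamNK 0)ᵀ * AfamNK 0) * (PNK t)ᵀ := by
  have hρ := rhoNK_transpose_mul_self ht₁ ht₂
  refine ⟨hρ, det_rhoNK ht₁ ht₂, ?_⟩
  have hρ' : rhoNK t * (rhoNK t)ᵀ = 1 := mul_eq_one_comm.mp hρ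
  simp [AfamNK, PNK, WfamNK_eq_smul_rhoNK, rhoNK_zero, fromBlocks_transpose,
    fromBlocks_multiply, hρ, hρ', smul_smul, mul_comm]
end
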